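/- For every integer n ≥ 1 and every natural number N, there exists a finite simplicial graph Γ, focused at some vertex, with trivial graph automorphism group and more than N vertices, such that there exist both an injective group homomorphism GL_n(ℤ) → Aut(Out(A_Γ)) and an injective group homomorphism PGL_n(ℤ) → Out(Out(A_Γ)). Consequently, every ℤ-linear group (every subgroup of some GL_n(ℤ)) acts faithfully by automorphisms on Out(A_Γ), and every projective ℤ-linear group acts faithfully by outer automorphisms on Out(A_Γ), for infinitely many right-angled Artin groups A_Γ. -/

import Mathlib

noncomputable section

/-- The subgroup of inner automorphisms inside `MulAut G`. -/
def Inn (G : Type) [Group G] : Subgroup (MulAut G) :=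
  (MulAut.conj : G →* MulAut G).range

instance Inn.normal (G : Type) [Group G] : (Inn G).Normal := by
  constructor
  rintro x ⟨g, rfl⟩ φ
  refine ⟨φ g, ?_⟩
  ext h
  simp [MulAut.mul_apply, MulAut.conj_apply, map_mul, map_inv]

/-- The outer automorphism group of `G`. -/
abbrev Out (G : Type) [Group G] := MulAut G ⧸ Inn G

/-- The set of commutator relators defining the RAAG of a graph. -/
def raagRels {V : Type} (G : SimpleGraph V) : Set (FreeGroup V) :=
  {r | ∃ u v : V, G.Adj u v ∧
    r = FreeGroup.of u * FreeGroup.of v * (FreeGroup.of u)⁻¹ * (FreeGroup.of v)⁻¹}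

/-- The right-angled Artin group of a graph. -/
abbrev RAAG {V : Type} (G : SimpleGraph V) := PresentedGroup (raagRels G)

/-- The standard generator of `RAAG G` corresponding to a vertex. -/
def gen {V : Type} (G : SimpleGraph V) (v : V) : RAAG G := PresentedGroup.of v

/-- The star of a vertex: the vertex together with its neighbours. -/
def star {V : Type} (G : SimpleGraph V) (v : V) : Set V := insert v (G.neighborSet v)

/-- `u` dominates `v` if `lk(v) ⊆ st(u)`. -/
def Dominates {V : Type} (G : SimpleGraph V) (u v : V) : Prop :=
  G.neighborSet v ⊆ star G u

/-- A graph has trivial automorphism group. -/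
def TrivialAut {V : Type} (G : SimpleGraph V) : Prop := ∀ e : G ≃g G, ∀ v, e v = v

/-- A graph is focused at a vertex `c`. -/
def Focused {V : Type} (G : SimpleGraph V) (c : V) : Prop :=
  (∀ u v : V, u ≠ v → Dominates G u v → u = c) ∧
  ∀ v : V, v ≠ c → (G.induce (star G v)ᶜ).Connected

/-- A graph is austere. -/
def Austere {V : Type} (G : SimpleGraph V) : Prop :=
  TrivialAut G ∧ (∀ u v : V, u ≠ v → ¬Dominates G u v) ∧
  ∀ v : V, (G.induce (star G v)ᶜ).Connected

/-- `P` is (the vertex set of) a connected component of the induced subgraph on `s`. -/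
def IsCompOf {V : Type} (G : SimpleGraph V) (s : Set V) (P : Set V) : Prop :=
  ∃ x : s, P = Subtype.val '' {y : s | (G.induce s).Reachable x y}

/-- `φ` is the inversion at the vertex `v`. -/
def IsInversion {V : Type} (G : SimpleGraph V) (φ : MulAut (RAAG G)) (v : V) : Prop :=
  φ (gen G v) = (gen G v)⁻¹ ∧ ∀ w : V, w ≠ v → φ (gen G w) = gen G w

/-- `φ` is the transvection `τ_{uv}` (`v ↦ uv`). -/
def IsTransvection {V : Type} (G : SimpleGraph V) (φ : MulAut (RAAG G)) (u v : V) : Prop :=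
  u ≠ v ∧ Dominates G u v ∧ φ (gen G v) = gen G u * gen G v ∧
    ∀ w : V, w ≠ v → φ (gen G w) = gen G w

/-- `φ` is the partial conjugation `χ_{v,P}`. -/
def IsPartialConj {V : Type} (G : SimpleGraph V) (φ : MulAut (RAAG G)) (v : V) (P : Set V) :
    Prop :=
  IsCompOf G (star G v)ᶜ P ∧ (∀ u ∈ P, φ (gen G u) = gen G v * gen G u * (gen G v)⁻¹) ∧
    ∀ w : V, w ∉ P → φ (gen G w) = gen G w

/-- The subgroup `I_Γ` of `Aut(A_Γ)` generated by the inversions. -/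
def InvSubgroup {V : Type} (G : SimpleGraph V) : Subgroup (MulAut (RAAG G)) :=
  Subgroup.closure {φ | ∃ v, IsInversion G φ v}

/-- The subgroup `PCT` of `Aut(A_Γ)` generated by transvections and partial conjugations. -/
def PCT {V : Type} (G : SimpleGraph V) : Subgroup (MulAut (RAAG G)) :=
  Subgroup.closure {φ | (∃ u v, IsTransvection G φ u v) ∨ ∃ v P, IsPartialConj G φ v P}

/-- The number `l` of vertices dominated by but not adjacent to `c`. -/
def lInv {V : Type} (G : SimpleGraph V) (c : V) : ℕ :=
  Nat.card {v : V | v ≠ c ∧ Dominates G c v ∧ ¬G.Adj c v}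

/-- The number `m` of vertices (other than `c`) dominated by `c`. -/
def mInv {V : Type} (G : SimpleGraph V) (c : V) : ℕ :=
  Nat.card {v : V | v ≠ c ∧ Dominates G c v}

/-- The number `k` of connected components of `Γ \ st(c)`. -/
def kInv {V : Type} (G : SimpleGraph V) (c : V) : ℕ :=
  Nat.card ((G.induce (star G c)ᶜ).ConnectedComponent)

/-- `GL_n(ℤ)`. -/
abbrev GLZ (n : ℕ) := Matrix.GeneralLinearGroup (Fin n) ℤ

/-- `PGL_n(ℤ)`, the quotient of `GL_n(ℤ)` by its centre `{±I}`. -/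
abbrev PGLZ (n : ℕ) := GLZ n ⧸ Subgroup.center (GLZ n)

/-- The principal level 2 congruence subgroup `Λ_l[2]` of `GL_l(ℤ)`. -/
def congr2 (l : ℕ) : Subgroup (GLZ l) :=
  (Matrix.GeneralLinearGroup.map (Int.castRingHom (ZMod 2)) :
    GLZ l →* Matrix.GeneralLinearGroup (Fin l) (ZMod 2)).ker

/-- The matrix `(1 1 / 0 -1)`. -/
def Bmat : Matrix (Fin 2) (Fin 2) ℤ := !![1, 1; 0, -1]

/-- A block-diagonal `2l × 2l` matrix whose `i`th `2 × 2` diagonal block is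
`Bmat` if `ε i` and the identity otherwise. -/
def Lmat (l : ℕ) (ε : Fin l → Bool) : Matrix (Fin l × Fin 2) (Fin l × Fin 2) ℤ :=
  fun a b =>
    if a.1 = b.1 then (if ε a.1 then Bmat a.2 b.2 else (1 : Matrix (Fin 2) (Fin 2) ℤ) a.2 b.2)
    else 0

/-- `GL_{2l}(ℤ)`, with rows and columns indexed by `Fin l × Fin 2`. -/
abbrev GL2l (l : ℕ) := Matrix.GeneralLinearGroup (Fin l × Fin 2) ℤ

/-- The subgroup `𝓛 ≤ GL_{2l}(ℤ)`. -/
def scriptL (l : ℕ) : Subgroup (GL2l l) :=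
  Subgroup.closure {M : GL2l l |
    ∃ ε : Fin l → Bool, (M : Matrix (Fin l × Fin 2) (Fin l × Fin 2) ℤ) = Lmat l ε}

/-- The index type realizing the block decomposition `d = 2l + p + q`. -/
abbrev BIdx (l p q : ℕ) := (Fin l × Fin 2) ⊕ (Fin p ⊕ Fin q)

/-- The block-diagonal matrix `Diag(D₁, D₂, ε·I_q)` with `D₁ ∈ 𝓛` given by `ε1`,
`D₂` diagonal with entries `d2`, and `ε = e`. -/
def Dmat (l p q : ℕ) (ε1 : Fin l → Bool) (d2 : Fin p → ℤˣ) (e : ℤˣ) :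
    Matrix (BIdx l p q) (BIdx l p q) ℤ := fun a b =>
  match a, b with
  | Sum.inl a, Sum.inl b => Lmat l ε1 a b
  | Sum.inr (Sum.inl i), Sum.inr (Sum.inl j) => if i = j then (d2 i : ℤ) else 0
  | Sum.inr (Sum.inr i), Sum.inr (Sum.inr j) => if i = j then (e : ℤ) else 0
  | _, _ => 0

/-- The subgroup `D ≤ GL_d(ℤ)` generated by `−I_d` and the block-diagonal matrices
`Diag(D₁, D₂, ε·I_q)`. -/
def DSub (l p q : ℕ) : Subgroup (Matrix.GeneralLinearGroup (BIdx l p q) ℤ) :=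
  Subgroup.closure
    ({M | (M : Matrix (BIdx l p q) (BIdx l p q) ℤ) = -1} ∪
     {M | ∃ ε1 d2 e, (M : Matrix (BIdx l p q) (BIdx l p q) ℤ) = Dmat l p q ε1 d2 e})

namespace RAAG

/-! ### Homomorphisms out of a right-angled Artin group -/

section Basics

variable {V : Type} {G : SimpleGraph V} {K : Type*} [Group K]

/-- The homomorphism out of a RAAG given by images of generators that commute along edges. -/
def lift (f : V → K) (h : ∀ u v, G.Adj u v → Commute (f u) (f v)) : RAAG G →* K :=
  PresentedGroup.toGroup (f := f) (by
    rintro _ ⟨u, v, huv, rfl⟩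
    simp [(h u v huv).eq])

@[simp]
lemma lift_gen (f : V → K) (h : ∀ u v, G.Adj u v → Commute (f u) (f v)) (v : V) :
    lift f h (gen G v) = f v :=
  PresentedGroup.toGroup.of _

lemma hom_ext {φ ψ : RAAG G →* K} (h : ∀ v, φ (gen G v) = ψ (gen G v)) : φ = ψ :=
  PresentedGroup.ext h

lemma gen_commute {u v : V} (h : G.Adj u v) : Commute (gen G u) (gen G v) := by
  have := PresentedGroup.one_of_mem (rels := raagRels G) ⟨u, v, h, rfl⟩
  simp only [map_mul, map_inv] at this
  exact commutatorElement_eq_one_iff_commute.mp this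

lemma mem_of_gen_mem (H : Subgroup (RAAG G)) (h : ∀ v, gen G v ∈ H) (g : RAAG G) : g ∈ H :=
  PresentedGroup.generated_by _ H h g

open scoped Classical in
/-- The exponent homomorphism of a vertex, in multiplicative notation. -/
def expHom (v : V) : RAAG G →* Multiplicative ℤ :=
  lift (fun w => if w = v then Multiplicative.ofAdd 1 else 1) fun _ _ _ => Commute.all _ _

/-- The exponent sum of the generator `v` in `g`. -/
def ex (g : RAAG G) (v : V) : ℤ := (expHom v g).toAdd

@[simp] lemma ex_one (v : V) : ex (1 : RAAG G) v = 0 := by simp [ex]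
@[simp] lemma ex_mul (g h : RAAG G) (v : V) : ex (g * h) v = ex g v + ex h v := by simp [ex]
@[simp] lemma ex_inv (g : RAAG G) (v : V) : ex g⁻¹ v = -ex g v := by simp [ex]
@[simp] lemma ex_zpow (g : RAAG G) (n : ℤ) (v : V) : ex (g ^ n) v = n * ex g v := by simp [ex]

open scoped Classical in
lemma ex_gen (v w : V) : ex (gen G v) w = if v = w then 1 else 0 := by
  unfold ex expHom
  rw [lift_gen]
  split_ifs <;> rfl

@[simp] lemma ex_gen_self (v : V) : ex (gen G v) v = 1 := by simp [ex_gen]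
lemma ex_gen_of_ne {v w : V} (h : v ≠ w) : ex (gen G v) w = 0 := by simp [ex_gen, h]

lemma ex_conj (t g : RAAG G) (v : V) : ex (t * g * t⁻¹) v = ex g v := by simp

/-! ### Standard parabolic subgroups and retractions -/

open scoped Classical in
/-- The retraction onto the standard parabolic subgroup of a set of vertices. -/
def ret (S : Set V) : RAAG G →* RAAG G :=
  lift (fun v => if v ∈ S then gen G v else 1) fun u v h => by
    split_ifs
    · exact gen_commute h
    all_goals simp

lemma ret_gen_of_mem {S : Set V} {v : V} (h : v ∈ S) : ret S (gen G v) = gen G v := by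
  simp [ret, h]

lemma ret_gen_of_notMem {S : Set V} {v : V} (h : v ∉ S) : ret S (gen G v) = 1 := by
  simp [ret, h]

/-- The standard parabolic subgroup of a set of vertices. -/
def par (S : Set V) : Subgroup (RAAG G) := (ret S).eqLocus (MonoidHom.id _)

lemma mem_par {S : Set V} {g : RAAG G} : g ∈ par S ↔ ret S g = g := Iff.rfl

lemma gen_mem_par {S : Set V} {v : V} (h : v ∈ S) : gen G v ∈ par S := ret_gen_of_mem h

lemma ret_ret (S T : Set V) (g : RAAG G) : ret S (ret T g) = ret (S ∩ T) g := by
  have : (ret S).comp (ret T) = ret (G := G) (S ∩ T) := hom_ext fun v => by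
    by_cases hT : v ∈ T <;> by_cases hS : v ∈ S <;>
      simp [ret, hS, hT]
  exact DFunLike.congr_fun this g

lemma ret_mem_par (S : Set V) (g : RAAG G) : ret S g ∈ par S := by
  rw [mem_par, ret_ret, Set.inter_self]

lemma ret_mem_par_inter {S T : Set V} {g : RAAG G} (h : g ∈ par T) : ret S g ∈ par (S ∩ T) := by
  rw [← mem_par.mp h, ret_ret]
  exact ret_mem_par _ _

lemma par_inter {S T : Set V} {g : RAAG G} (hS : g ∈ par S) (hT : g ∈ par T) :
    g ∈ par (S ∩ T) := by
  have := ret_mem_par_inter (S := S) hT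
  rwa [mem_par.mp hS] at this

lemma par_mono {S T : Set V} (h : S ⊆ T) {g : RAAG G} (hg : g ∈ par S) : g ∈ par T := by
  rw [mem_par, ← mem_par.mp hg, ret_ret, Set.inter_eq_right.mpr h]

/-- An element lying in all the maximal parabolics avoiding a vertex outside `T` lies in
the parabolic of `T`. -/
lemma mem_par_of_forall [Finite V] {T : Set V} {g : RAAG G} (h : ∀ u ∉ T, g ∈ par {u}ᶜ) :
    g ∈ par T := by
  classical
  have := Fintype.ofFinite V
  suffices H : ∀ s : Finset V, (∀ u ∈ s, u ∉ T) → g ∈ par (↑s)ᶜ by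
    refine par_mono ?_ (H (Finset.univ.filter (· ∉ T)) (by simp))
    intro v hv
    simpa using hv
  intro s
  induction s using Finset.induction_on with
  | empty =>
    intro _
    exact par_mono (S := Set.univ) (by simp) (by
      rw [mem_par]
      have : ret (G := G) Set.univ = MonoidHom.id _ := hom_ext fun v => by simp [ret]
      simp [this])
  | insert a s ha ih =>
    intro hs
    refine par_mono ?_ (par_inter (h a (hs a (by simp))) (ih fun u hu => hs u (by simp [hu])))
    intro v hv
    simpa [not_or] using hv

lemma ex_ret_of_notMem {S : Set V} {v : V} (hv : v ∉ S) (g : RAAG G) : ex (ret S g) v = 0 := by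
  have : (expHom v).comp (ret S) = (1 : RAAG G →* Multiplicative ℤ) := hom_ext fun w => by
    by_cases hw : w ∈ S
    · have : w ≠ v := fun h => hv (h ▸ hw)
      simp [ret, hw, expHom, this]
    · simp [ret, hw]
  have := DFunLike.congr_fun this g
  simpa [ex] using this

lemma ex_of_mem_par {S : Set V} {v : V} (hv : v ∉ S) {g : RAAG G} (hg : g ∈ par S) :
    ex g v = 0 := by
  rw [← mem_par.mp hg, ex_ret_of_notMem hv]

/-- An element of the parabolic of `S` commutes with everything commuting with `S`. -/
lemma commute_of_mem_par {S : Set V} {g x : RAAG G} (hg : g ∈ par S)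
    (h : ∀ v ∈ S, Commute (gen G v) x) : Commute g x := by
  have key : ∀ g : RAAG G, g ∈ (Subgroup.centralizer {x}).comap (ret S) :=
    mem_of_gen_mem _ fun v => by
      rw [Subgroup.mem_comap, Subgroup.mem_centralizer_singleton_iff]
      by_cases hv : v ∈ S
      · rw [ret_gen_of_mem hv]; exact (h v hv).eq
      · simp [ret_gen_of_notMem hv]
  have := key g
  rw [Subgroup.mem_comap, Subgroup.mem_centralizer_singleton_iff, mem_par.mp hg] at this
  exact this

lemma commute_gen_of_mem_par_star {v : V} {g : RAAG G} (hg : g ∈ par (star G v)) :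
    Commute g (gen G v) :=
  commute_of_mem_par hg fun w hw => by
    rcases hw with rfl | hw
    · exact Commute.refl _
    · exact (gen_commute hw).symm

lemma eq_zpow_of_mem_par_singleton {c : V} {g : RAAG G} (hg : g ∈ par {c}) :
    ∃ m : ℤ, g = gen G c ^ m := by
  have key : ∀ g : RAAG G, g ∈ (Subgroup.zpowers (gen G c)).comap (ret {c}) :=
    mem_of_gen_mem _ fun v => by
      rw [Subgroup.mem_comap]
      by_cases hv : v = c
      · rw [ret_gen_of_mem (by simpa using hv), hv]; exact Subgroup.mem_zpowers _
      · rw [ret_gen_of_notMem (by simpa using hv)]; exact one_mem _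
  have := key g
  rw [Subgroup.mem_comap, mem_par.mp hg] at this
  obtain ⟨m, hm⟩ := this
  exact ⟨m, hm.symm⟩

/-! ### The Helly property for cosets of standard parabolic subgroups -/

lemma exists_mul_of_mem_par {S T R : Set V} {t r : RAAG G} (ht : t ∈ par T) (hr : r ∈ par R)
    (h : t * r ∈ par S) :
    ∃ t' ∈ par (G := G) (S ∩ T), ∃ r' ∈ par (G := G) (S ∩ R), t * r = t' * r' :=
  ⟨_, ret_mem_par_inter ht, _, ret_mem_par_inter hr, by rw [← map_mul, mem_par.mp h]⟩

lemma helly_three {S T R : Set V} {x y z p q r : RAAG G}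
    (hpx : x⁻¹ * p ∈ par S) (hpy : y⁻¹ * p ∈ par T)
    (hqx : x⁻¹ * q ∈ par S) (hqz : z⁻¹ * q ∈ par R)
    (hry : y⁻¹ * r ∈ par T) (hrz : z⁻¹ * r ∈ par R) :
    ∃ w, x⁻¹ * w ∈ par S ∧ y⁻¹ * w ∈ par T ∧ z⁻¹ * w ∈ par R := by
  have h1 : p⁻¹ * r ∈ par T := by
    have := mul_mem (inv_mem hpy) hry
    simpa [mul_assoc] using this
  have h2 : r⁻¹ * q ∈ par R := by
    have := mul_mem (inv_mem hrz) hqz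
    simpa [mul_assoc] using this
  have h3 : p⁻¹ * r * (r⁻¹ * q) ∈ par S := by
    have := mul_mem (inv_mem hpx) hqx
    simpa [mul_assoc] using this
  obtain ⟨t, ht, s, hs, hts⟩ := exists_mul_of_mem_par h1 h2 h3
  refine ⟨p * t, ?_, ?_, ?_⟩
  · rw [← mul_assoc]
    exact mul_mem hpx (par_mono Set.inter_subset_left ht)
  · rw [← mul_assoc]
    exact mul_mem hpy (par_mono Set.inter_subset_right ht)
  · have : p * t = q * s⁻¹ := by
      have : p⁻¹ * q = t * s := by rw [← hts]; group
      rw [← mul_inv_eq_iff_eq_mul] at this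
      rw [← this]; group
    rw [this, ← mul_assoc]
    exact mul_mem hqz (inv_mem (par_mono Set.inter_subset_right hs))

/-- Finitely many pairwise intersecting cosets of standard parabolic subgroups have a common
element. -/
lemma helly {ι : Type*} (s : Finset ι) (x : ι → RAAG G) (S : ι → Set V)
    (h : ∀ i ∈ s, ∀ j ∈ s, ∃ p, (x i)⁻¹ * p ∈ par (S i) ∧ (x j)⁻¹ * p ∈ par (S j)) :
    ∃ p, ∀ i ∈ s, (x i)⁻¹ * p ∈ par (S i) := by
  classical
  induction s using Finset.induction_on generalizing x S with
  | empty => exact ⟨1, by simp⟩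
  | insert a s ha ih =>
    have hp : ∀ i, ∃ p, i ∈ s → (x a)⁻¹ * p ∈ par (S a) ∧ (x i)⁻¹ * p ∈ par (S i) := fun i => by
      by_cases hi : i ∈ s
      · obtain ⟨p, hp⟩ := h a (by simp) i (by simp [hi])
        exact ⟨p, fun _ => hp⟩
      · exact ⟨1, fun h => absurd h hi⟩
    choose p hp using hp
    obtain ⟨w, hw⟩ := ih p (fun i => S a ∩ S i) fun i hi j hj => by
      obtain ⟨r, hri, hrj⟩ := h i (by simp [hi]) j (by simp [hj])
      obtain ⟨w, hwa, hwi, hwj⟩ := helly_three (hp i hi).1 (hp i hi).2 (hp j hj).1 (hp j hj).2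
        hri hrj
      have aux : ∀ k ∈ s, (x k)⁻¹ * w ∈ par (S k) → (p k)⁻¹ * w ∈ par (S a ∩ S k) :=
        fun k hk hwk => by
          refine par_inter ?_ ?_
          · have := mul_mem (inv_mem (hp k hk).1) hwa
            simpa [mul_assoc] using this
          · have := mul_mem (inv_mem (hp k hk).2) hwk
            simpa [mul_assoc] using this
      exact ⟨w, aux i hi hwi, aux j hj hwj⟩
    rcases s.eq_empty_or_nonempty with rfl | ⟨b, hb⟩
    · exact ⟨x a, by simp⟩
    · refine ⟨w, fun i hi => ?_⟩
      have aux : ∀ k ∈ s, (x a)⁻¹ * w ∈ par (S a) ∧ (x k)⁻¹ * w ∈ par (S k) := fun k hk => by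
        have h1 := mul_mem (hp k hk).1 (par_mono Set.inter_subset_left (hw k hk))
        have h2 := mul_mem (hp k hk).2 (par_mono Set.inter_subset_right (hw k hk))
        exact ⟨by simpa [mul_assoc] using h1, by simpa [mul_assoc] using h2⟩
      rcases Finset.mem_insert.mp hi with rfl | hi
      · exact (aux b hb).1
      · exact (aux i hi).2

end Basics

end RAAG

/-! ### Commuting pairs in a semidirect product of a free group by a permutation action -/

namespace FreeGroupAction

open FreeGroup

section Words

variable {X : Type*} [DecidableEq X]

lemma toWord_mul_of_head_ne {f g : FreeGroup X}
    (h : ∀ a, f⁻¹.toWord.head? = some a → g.toWord.head? ≠ some a) :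
    (f * g).toWord = f.toWord ++ g.toWord := by
  rw [toWord_mul, IsReduced.reduce_eq]
  refine List.isChain_append.mpr ⟨isReduced_toWord, isReduced_toWord, ?_⟩
  rintro ⟨x, b⟩ hx ⟨y, b'⟩ hy rfl
  by_contra hb
  refine h (x, b') ?_ hy
  have hb' : b' = !b := by cases b <;> cases b' <;> simp_all
  rw [toWord_inv, invRev, List.head?_reverse, List.getLast?_map, Option.mem_def.mp hx, hb']
  rfl

lemma norm_mul_lt {f g : FreeGroup X} {a : X × Bool} (hf : f⁻¹.toWord.head? = some a)
    (hg : g.toWord.head? = some a) : FreeGroup.norm (f * g) < FreeGroup.norm f + FreeGroup.norm g := by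
  obtain ⟨s, hs⟩ := List.head?_eq_some_iff.mp hf
  obtain ⟨t, ht⟩ := List.head?_eq_some_iff.mp hg
  have hf' : f = (mk s)⁻¹ * (mk [a])⁻¹ := by
    rw [← mul_inv_rev, eq_inv_iff_mul_eq_one, mul_mk, List.singleton_append, ← hs, mk_toWord,
      mul_inv_cancel]
  have hg' : g = mk [a] * mk t := by
    rw [mul_mk, List.singleton_append, ← ht, mk_toWord]
  have hprod : f * g = (mk s)⁻¹ * mk t := by rw [hf', hg']; group
  have h1 : FreeGroup.norm f = s.length + 1 := by
    rw [← norm_inv_eq, FreeGroup.norm, hs, List.length_cons]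
  have h2 : FreeGroup.norm g = t.length + 1 := by rw [FreeGroup.norm, ht, List.length_cons]
  have h3 := norm_mul_le (mk s)⁻¹ (mk t)
  rw [norm_inv_eq] at h3
  have h4 : FreeGroup.norm (mk s) ≤ s.length := norm_mk_le
  have h5 : FreeGroup.norm (mk t) ≤ t.length := norm_mk_le
  rw [hprod]
  omega

lemma toWord_freeGroupCongr (e : Equiv.Perm X) (f : FreeGroup X) :
    (freeGroupCongr e f).toWord = f.toWord.map fun p => (e p.1, p.2) := by
  conv_lhs => rw [← mk_toWord (x := f)]
  change (FreeGroup.map e (mk f.toWord)).toWord = _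
  rw [map.mk, toWord_mk, IsReduced.reduce_eq]
  refine (List.isChain_map _).mpr ?_
  refine List.IsChain.imp ?_ (isReduced_toWord (x := f))
  intro a b hab h
  exact hab (e.injective h)

end Words

variable {X H : Type*} [Group H] [MulAction H X]

/-- The action on a free group permuting the basis. -/
def permAut (H X : Type*) [Group H] [MulAction H X] : H →* MulAut (FreeGroup X) where
  toFun h := freeGroupCongr (MulAction.toPerm h)
  map_one' := by
    ext f
    change FreeGroup.map _ f = f
    convert FreeGroup.map.id f using 2
    ext x
    simp
  map_mul' g h := by
    ext f
    change FreeGroup.map _ f = FreeGroup.map _ (FreeGroup.map _ f)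
    rw [FreeGroup.map.comp]
    congr 2
    ext x
    simp [mul_smul]

lemma permAut_of (h : H) (x : X) : permAut H X h (of x) = of (h • x) := by
  change FreeGroup.map _ (of x) = _
  simp

section

variable [DecidableEq X]

lemma toWord_permAut (h : H) (f : FreeGroup X) :
    (permAut H X h f).toWord = f.toWord.map fun p => (h • p.1, p.2) :=
  toWord_freeGroupCongr _ _

lemma norm_permAut (h : H) (f : FreeGroup X) : FreeGroup.norm (permAut H X h f) = FreeGroup.norm f := by
  simp [FreeGroup.norm, toWord_permAut]

lemma head_permAut (h : H) (f : FreeGroup X) :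
    (permAut H X h f).toWord.head? = f.toWord.head?.map fun p => (h • p.1, p.2) := by
  rw [toWord_permAut, List.head?_map]

lemma smul_eq_of_permAut_eq {h : H} {f : FreeGroup X} (hf : f ≠ 1)
    (h' : permAut H X h f = f) : ∃ x : X, x ∈ f.toWord.map Prod.fst ∧ h • x = x := by
  have hne : f.toWord ≠ [] := fun h => hf (toWord_eq_nil_iff.mp h)
  obtain ⟨a, s, hs⟩ := List.exists_cons_of_ne_nil hne
  refine ⟨a.1, by simp [hs], ?_⟩
  have := toWord_permAut h f
  rw [h', hs, List.map_cons, List.cons.injEq] at this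
  exact (congrArg Prod.fst this.1).symm

/-- The word length of the free part. -/
def len (x : FreeGroup X ⋊[permAut H X] H) : ℕ := FreeGroup.norm x.left

/-- The first letter of the free part. -/
def hd (x : FreeGroup X ⋊[permAut H X] H) : Option (X × Bool) := x.left.toWord.head?

variable {x y : FreeGroup X ⋊[permAut H X] H}

lemma len_eq_zero : len x = 0 ↔ x.left = 1 := norm_eq_zero

lemma hd_eq_none (h : hd x = none) : x.left = 1 := by
  rwa [hd, List.head?_eq_none_iff, toWord_eq_nil_iff] at h

lemma len_inv : len x⁻¹ = len x := by
  rw [len, SemidirectProduct.inv_left, norm_permAut, norm_inv_eq, len]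

lemma hd_inv : x.left⁻¹.toWord.head? = (hd x⁻¹).map fun p => (x.right • p.1, p.2) := by
  rw [hd, ← head_permAut, SemidirectProduct.inv_left, ← MulAut.mul_apply, ← _root_.map_mul]
  simp

lemma toWord_mul_left (h : hd x⁻¹ ≠ hd y) :
    (x * y).left.toWord = x.left.toWord ++ (permAut H X x.right y.left).toWord := by
  rw [SemidirectProduct.mul_left]
  refine toWord_mul_of_head_ne fun a ha hb => ?_
  rw [hd_inv] at ha
  rw [head_permAut] at hb
  obtain ⟨p, hp, rfl⟩ := Option.map_eq_some_iff.mp ha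
  obtain ⟨q, hq, hpq⟩ := Option.map_eq_some_iff.mp hb
  rw [Prod.mk.injEq] at hpq
  have : q = p := Prod.ext (smul_left_cancel _ hpq.1) hpq.2
  rw [this] at hq
  exact h (hp.trans hq.symm)

lemma len_mul (h : hd x⁻¹ ≠ hd y) : len (x * y) = len x + len y := by
  have := congrArg List.length (toWord_mul_left h)
  rw [List.length_append] at this
  rw [len, FreeGroup.norm, this]
  change _ + FreeGroup.norm _ = _
  rw [norm_permAut]
  rfl

lemma len_mul_lt (h : hd x⁻¹ = hd y) (hy : y.left ≠ 1) : len (x * y) < len x + len y := by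
  cases ha : hd y with
  | none => exact absurd (hd_eq_none ha) hy
  | some a =>
    rw [ha] at h
    have := norm_mul_lt (f := x.left) (g := permAut H X x.right y.left)
      (a := (x.right • a.1, a.2)) (by rw [hd_inv, h]; rfl)
      (by rw [head_permAut]; change (hd y).map _ = _; rw [ha]; rfl)
    rwa [norm_permAut] at this

lemma hd_ne_symm (hxy : Commute x y) (hx : x.left ≠ 1) (h : hd x⁻¹ ≠ hd y) :
    hd y⁻¹ ≠ hd x := fun h' => by
  have h1 := len_mul h
  have h2 := len_mul_lt h' hx
  rw [hxy.eq] at h1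
  omega

lemma len_inv_mul_lt (hxy : Commute x y) (hx : x.left ≠ 1)
    (h : hd x⁻¹ ≠ hd y) (hle : len x ≤ len y) : len (x⁻¹ * y) < len y := by
  have h1 := toWord_mul_left h
  have h2 := toWord_mul_left (hd_ne_symm hxy hx h)
  rw [hxy.eq, h2] at h1
  obtain ⟨s, hs⟩ := List.prefix_of_prefix_length_le ⟨_, rfl⟩ ⟨_, h1⟩ hle
  have hs' : x.left * mk s = y.left := by
    rw [← mk_toWord (x := y.left), ← hs, ← mul_mk, mk_toWord]
  have h3 : len (x⁻¹ * y) ≤ s.length := by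
    rw [len, SemidirectProduct.mul_left, SemidirectProduct.inv_left,
      SemidirectProduct.inv_right, ← _root_.map_mul, norm_permAut, ← hs', inv_mul_cancel_left]
    exact norm_mk_le
  have h4 : len x + s.length = len y := by
    rw [len, len, FreeGroup.norm, FreeGroup.norm, ← hs, List.length_append]
  have h5 : len x ≠ 0 := fun h => hx (len_eq_zero.mp h)
  omega

lemma len_conj_lt {a : X × Bool} (h : hd x = some a) (h' : hd x⁻¹ = some a) :
    len ((SemidirectProduct.inl (mk [a]))⁻¹ * x * SemidirectProduct.inl (mk [a])) < len x := by
  obtain ⟨s, hs⟩ := List.head?_eq_some_iff.mp h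
  have hinv := hd_inv (x := x)
  rw [h', Option.map_some, toWord_inv, invRev, List.head?_reverse, List.getLast?_map,
    Option.map_eq_some_iff] at hinv
  obtain ⟨b, hb, hba⟩ := hinv
  rw [Prod.mk.injEq] at hba
  have hlast : b = (x.right • a.1, !a.2) := Prod.ext hba.1 (by simp [← hba.2])
  rw [hs] at hb
  rcases List.eq_nil_or_concat s with rfl | ⟨r, b', rfl⟩
  · simp only [List.getLast?_singleton, Option.some.injEq] at hb
    rw [hlast] at hb
    have := congrArg Prod.snd hb
    simp at this
  · rw [List.concat_eq_append, ← List.cons_append, List.getLast?_concat, Option.some.injEq] at hb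
    have hx : x.left = mk [a] * mk r * (permAut H X x.right (mk [a]))⁻¹ := by
      rw [← mk_toWord (x := x.left), hs, hb, hlast]
      change _ = _ * _ * (FreeGroup.map _ (mk [a]))⁻¹
      rw [map.mk, inv_mk, mul_mk, mul_mk]
      simp [invRev]
    have hleft : ((SemidirectProduct.inl (mk [a]))⁻¹ * x *
        SemidirectProduct.inl (mk [a]) : FreeGroup X ⋊[permAut H X] H).left = mk r := by
      simp only [SemidirectProduct.mul_left, SemidirectProduct.inv_left,
        SemidirectProduct.mul_right, SemidirectProduct.inv_right, SemidirectProduct.left_inl,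
        SemidirectProduct.right_inl, inv_one, _root_.map_one, MulAut.one_apply, one_mul]
      rw [hx]
      group
    have h1 : len x = r.length + 2 := by
      rw [len, FreeGroup.norm, hs]; simp
    have h2 : FreeGroup.norm (mk r) ≤ r.length := norm_mk_le
    rw [len, hleft]
    omega

end

/-- Some primitive combination of `x` and `y` is conjugate into the acting group. -/
def HasElliptic (x y : FreeGroup X ⋊[permAut H X] H) : Prop :=
  ∃ a b : ℤ, IsCoprime a b ∧ ∃ t k, t * (x ^ a * y ^ b) * t⁻¹ = SemidirectProduct.inr k

variable {x y : FreeGroup X ⋊[permAut H X] H}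

lemma HasElliptic.swap (hxy : Commute x y) (h : HasElliptic y x) : HasElliptic x y := by
  obtain ⟨a, b, hab, t, k, h⟩ := h
  exact ⟨b, a, hab.symm, t, k, by rw [← h, (hxy.zpow_zpow b a).eq]⟩

lemma HasElliptic.of_inv (h : HasElliptic x y⁻¹) : HasElliptic x y := by
  obtain ⟨a, b, hab, t, k, h⟩ := h
  exact ⟨a, -b, hab.neg_right, t, k, by rw [← h]; simp⟩

lemma HasElliptic.of_inv_mul (hxy : Commute x y) (h : HasElliptic x (x⁻¹ * y)) :
    HasElliptic x y := by
  obtain ⟨a, b, hab, t, k, h⟩ := h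
  refine ⟨a - b, b, ?_, t, k, ?_⟩
  · have := IsCoprime.add_mul_right_left hab (-1)
    rwa [neg_one_mul, ← sub_eq_add_neg] at this
  · rw [← h, (hxy.inv_left).mul_zpow, zpow_sub, inv_zpow, mul_assoc (x ^ a)]

lemma HasElliptic.of_conj (s : FreeGroup X ⋊[permAut H X] H)
    (h : HasElliptic (s⁻¹ * x * s) (s⁻¹ * y * s)) : HasElliptic x y := by
  obtain ⟨a, b, hab, t, k, h⟩ := h
  refine ⟨a, b, hab, t * s⁻¹, k, ?_⟩
  have key : ∀ (z : FreeGroup X ⋊[permAut H X] H) (n : ℤ),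
      (s⁻¹ * z * s) ^ n = s⁻¹ * z ^ n * s := fun z n => by
    have := conj_zpow (i := n) (a := s⁻¹) (b := z)
    rwa [inv_inv] at this
  rw [← h, key, key]
  group

theorem hasElliptic_of_commute (hxy : Commute x y) : HasElliptic x y := by
  classical
  induction hn : len x + len y using Nat.strong_induction_on generalizing x y with
  | _ n ih =>
  by_cases hx : x.left = 1
  · refine ⟨1, 0, isCoprime_one_left, 1, x.right, ?_⟩
    ext <;> simp [hx]
  by_cases hy : y.left = 1
  · refine ⟨0, 1, isCoprime_one_right, 1, y.right, ?_⟩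
    ext <;> simp [hy]
  have step : ∀ y : FreeGroup X ⋊[permAut H X] H, Commute x y → y.left ≠ 1 →
      len x + len y = n → hd x⁻¹ ≠ hd y → HasElliptic x y := by
    intro y hxy hy hn hne
    rcases le_total (len x) (len y) with hle | hle
    · have := len_inv_mul_lt hxy hx hne hle
      exact .of_inv_mul hxy (ih _ (by omega) ((Commute.refl x).inv_right.mul_right hxy) rfl)
    · have := len_inv_mul_lt hxy.symm hy (hd_ne_symm hxy hx hne) hle
      exact .swap hxy (.of_inv_mul hxy.symm
        (ih _ (by omega) ((Commute.refl y).inv_right.mul_right hxy.symm) rfl))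
  by_cases h1 : hd x⁻¹ = hd y
  swap
  · exact step y hxy hy hn h1
  by_cases h2 : hd x⁻¹ = hd y⁻¹
  swap
  · refine .of_inv (step y⁻¹ hxy.inv_right (fun h => hy ?_) (by rw [len_inv, hn]) h2)
    rw [← len_eq_zero, len_inv] at h
    exact len_eq_zero.mp h
  have h3 : hd y⁻¹ = hd x := by
    by_contra h
    exact hd_ne_symm hxy.symm hy h h1
  cases ha : hd x with
  | none => exact absurd (hd_eq_none ha) hx
  | some a =>
    have hxa : hd x⁻¹ = some a := by rw [h2, h3, ha]
    have hya : hd y = some a := by rw [← h1, hxa]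
    have hya' : hd y⁻¹ = some a := by rw [h3, ha]
    have l1 := len_conj_lt ha hxa
    have l2 := len_conj_lt hya hya'
    refine .of_conj (SemidirectProduct.inl (mk [a])) (ih _ (by omega) ?_ rfl)
    have := (Commute.conj_iff (SemidirectProduct.inl (φ := permAut H X) (mk [a]))⁻¹).mpr hxy
    simpa using this

end FreeGroupAction

/-! ### Splitting off a vertex -/

namespace RAAG

open FreeGroupAction SemidirectProduct

variable {V : Type} {G : SimpleGraph V}

lemma neighborSet_subset_star (u : V) : G.neighborSet u ⊆ star G u := Set.subset_insert _ _

/-- The cosets of the parabolic subgroup of the link of `u`. -/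
abbrev LinkCoset (G : SimpleGraph V) (u : V) := RAAG G ⧸ (par (G.neighborSet u) : Subgroup (RAAG G))

/-- The free group on the cosets of the link of `u`, extended by the translation action. -/
abbrev Split (G : SimpleGraph V) (u : V) :=
  FreeGroup (LinkCoset G u) ⋊[permAut (RAAG G) (LinkCoset G u)] RAAG G

lemma commute_inl_inr {u w : V} (h : G.Adj u w) :
    Commute (inl (FreeGroup.of ((1 : RAAG G) : LinkCoset G u)) : Split G u) (inr (gen G w)) := by
  have h1 := inl_aut (φ := permAut (RAAG G) (LinkCoset G u)) (gen G w)
    (FreeGroup.of ((1 : RAAG G) : LinkCoset G u))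
  have h2 : gen G w • ((1 : RAAG G) : LinkCoset G u) = ((1 : RAAG G) : LinkCoset G u) := by
    rw [MulAction.Quotient.smul_coe, QuotientGroup.eq]
    simpa using gen_mem_par (G := G) (show w ∈ G.neighborSet u from h)
  rw [permAut_of, h2, map_inv, eq_mul_inv_iff_mul_eq] at h1
  exact h1

open scoped Classical in
/-- The homomorphism turning the generator `u` into a free letter. -/
def toSplit (G : SimpleGraph V) (u : V) : RAAG G →* Split G u :=
  lift (fun v => if v = u then inl (FreeGroup.of ((1 : RAAG G) : LinkCoset G u))
    else inr (gen G v)) fun v w h => by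
    by_cases hv : v = u <;> by_cases hw : w = u
    · exact absurd (hv.trans hw.symm) h.ne
    · subst hv
      simpa [hw] using commute_inl_inr h
    · subst hw
      simpa [hv] using (commute_inl_inr h.symm).symm
    · simpa [hv, hw] using (gen_commute h).map inr

lemma toSplit_gen_self (u : V) :
    toSplit G u (gen G u) = inl (FreeGroup.of ((1 : RAAG G) : LinkCoset G u)) := by
  simp [toSplit]

lemma toSplit_gen_of_ne {u v : V} (h : v ≠ u) : toSplit G u (gen G v) = inr (gen G v) := by
  simp [toSplit, h]

lemma commute_gen_of_mem_par_neighborSet {u : V} {g : RAAG G} (h : g ∈ par (G.neighborSet u)) :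
    Commute g (gen G u) :=
  commute_gen_of_mem_par_star (par_mono (neighborSet_subset_star u) h)

/-- The conjugate of `u` determined by a coset of its link. -/
def conjGen (u : V) (q : LinkCoset G u) : RAAG G :=
  Quotient.liftOn' q (fun g => g * gen G u * g⁻¹) fun a b h => by
    have h1 := (commute_gen_of_mem_par_neighborSet (QuotientGroup.leftRel_apply.mp h)).eq
    rw [mul_inv_eq_iff_eq_mul, ← mul_left_cancel_iff (a := a⁻¹)]
    calc _ = gen G u * (a⁻¹ * b) * b⁻¹ * a := by group
      _ = _ := by rw [← h1]; group

lemma conjGen_mk (u : V) (g : RAAG G) : conjGen u (g : LinkCoset G u) = g * gen G u * g⁻¹ := rfl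

/-- The left inverse of `toSplit`. -/
def fromSplit (G : SimpleGraph V) (u : V) : Split G u →* RAAG G :=
  SemidirectProduct.lift (FreeGroup.lift (conjGen u)) (MonoidHom.id _) fun g => by
    refine FreeGroup.ext_hom _ _ fun q => ?_
    induction q using QuotientGroup.induction_on with
    | H a =>
      simp only [MonoidHom.coe_comp, Function.comp_apply, MulEquiv.coe_toMonoidHom, permAut_of,
        MulAction.Quotient.smul_coe, FreeGroup.lift_apply_of, conjGen_mk, MonoidHom.id_apply,
        MulAut.conj_apply, smul_eq_mul]
      group

lemma fromSplit_inr (u : V) (g : RAAG G) : fromSplit G u (inr g) = g := by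
  simp [fromSplit]

lemma fromSplit_toSplit (u : V) (g : RAAG G) : fromSplit G u (toSplit G u g) = g := by
  have : (fromSplit G u).comp (toSplit G u) = MonoidHom.id _ := hom_ext fun v => by
    by_cases hv : v = u
    · subst hv
      simp [toSplit_gen_self, fromSplit, conjGen_mk]
    · simp [toSplit_gen_of_ne hv, fromSplit_inr]
  exact DFunLike.congr_fun this g

lemma toSplit_right (u : V) (g : RAAG G) : (toSplit G u g).right = ret {u}ᶜ g := by
  have : rightHom.comp (toSplit G u) = ret {u}ᶜ := hom_ext fun v => by
    by_cases hv : v = u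
    · subst hv
      simp [toSplit_gen_self, ret_gen_of_notMem]
    · simp [toSplit_gen_of_ne hv, ret_gen_of_mem, hv]
  exact DFunLike.congr_fun this g

lemma toSplit_of_mem {u : V} {g : RAAG G} (h : g ∈ par {u}ᶜ) : toSplit G u g = inr g := by
  have : (toSplit G u).comp (ret {u}ᶜ) = inr.comp (ret {u}ᶜ) := hom_ext fun v => by
    by_cases hv : v = u
    · simp [ret_gen_of_notMem, hv]
    · simp [toSplit_gen_of_ne hv, ret_gen_of_mem, hv]
  have := DFunLike.congr_fun this g
  simpa [mem_par.mp h] using this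

lemma mem_par_of_left_eq_one {u : V} {g : RAAG G} (h : (toSplit G u g).left = 1) :
    g ∈ par {u}ᶜ := by
  have : toSplit G u g = inr (ret {u}ᶜ g) := by
    rw [← toSplit_right]
    ext <;> simp [h]
  rw [mem_par]
  conv_rhs => rw [← fromSplit_toSplit u g, this, fromSplit_inr]

lemma exists_conj_mem_of_smul_eq {u : V} {z : RAAG G} {q : LinkCoset G u} (h : z • q = q) :
    ∃ t, t⁻¹ * z * t ∈ par (G := G) (G.neighborSet u) := by
  induction q using QuotientGroup.induction_on with
  | H t =>
    refine ⟨t, ?_⟩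
    rw [eq_comm, MulAction.Quotient.smul_coe, QuotientGroup.eq] at h
    rwa [mul_assoc]

lemma exists_conj_mem_of_commute_inr {u : V} {z : RAAG G} {y : Split G u}
    (h : Commute y (inr z)) (hy : y.left ≠ 1) :
    ∃ t, t⁻¹ * z * t ∈ par (G := G) (G.neighborSet u) := by
  have h1 := congrArg SemidirectProduct.left h.eq
  simp only [mul_left, left_inr, right_inr, map_one, mul_one, one_mul] at h1
  classical
  obtain ⟨q, -, hq⟩ := smul_eq_of_permAut_eq hy h1.symm
  exact exists_conj_mem_of_smul_eq hq

/-- An element commuting with an element of a maximal parabolic lies in that parabolic, unless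
the latter element is conjugate into the link. -/
lemma mem_par_or_of_commute {u : V} {z x : RAAG G} (hz : z ∈ par {u}ᶜ) (h : Commute x z) :
    x ∈ par {u}ᶜ ∨ ∃ t, t⁻¹ * z * t ∈ par (G := G) (G.neighborSet u) := by
  by_cases hx : (toSplit G u x).left = 1
  · exact .inl (mem_par_of_left_eq_one hx)
  · refine .inr (exists_conj_mem_of_commute_inr (y := toSplit G u x) ?_ hx)
    rw [← toSplit_of_mem hz]
    exact h.map _

/-- `x` is conjugate into the parabolic subgroup of `S`. -/
def ConjInto (x : RAAG G) (S : Set V) : Prop := ∃ t, t * x * t⁻¹ ∈ par (G := G) S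

lemma conjInto_of_toSplit_conj {u : V} {x k : RAAG G} {t : Split G u}
    (h : t * toSplit G u x * t⁻¹ = inr k) : ConjInto x {u}ᶜ := by
  have h1 := congrArg (fromSplit G u) h
  have h2 := congrArg SemidirectProduct.right h
  simp only [map_mul, map_inv, fromSplit_toSplit, fromSplit_inr, mul_right, inv_right,
    toSplit_right, right_inr] at h1 h2
  refine ⟨t.right⁻¹ * fromSplit G u t, ?_⟩
  have : t.right⁻¹ * fromSplit G u t * x * (t.right⁻¹ * fromSplit G u t)⁻¹ = ret {u}ᶜ x := by
    calc _ = t.right⁻¹ * (fromSplit G u t * x * (fromSplit G u t)⁻¹) * t.right := by group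
      _ = _ := by rw [h1, ← h2]; group
  rw [this]
  exact ret_mem_par _ _

lemma exists_ex_eq_zero_of_commute {u : V} {x y : RAAG G} (h : Commute x y)
    (hx : ¬ConjInto x {u}ᶜ) :
    ∃ a b : ℤ, b ≠ 0 ∧ ∀ w, ¬G.Adj u w → a * ex x w + b * ex y w = 0 := by
  obtain ⟨a, b, hab, t, k, hk⟩ := hasElliptic_of_commute (h.map (toSplit G u))
  have hb : b ≠ 0 := by
    rintro rfl
    refine hx ?_
    rw [isCoprime_zero_right, Int.isUnit_iff] at hab
    rcases hab with rfl | rfl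
    · exact conjInto_of_toSplit_conj (t := t) (k := k) (by simpa using hk)
    · refine conjInto_of_toSplit_conj (t := t) (k := k⁻¹) ?_
      rw [map_inv, ← hk]
      group
  refine ⟨a, b, hb, ?_⟩
  have hcomm : Commute (t * toSplit G u x * t⁻¹) (inr k) := by
    rw [← hk]
    refine (Commute.conj_iff t).mpr ?_
    exact ((Commute.refl _).zpow_right a).mul_right ((h.map (toSplit G u)).zpow_right b)
  have hleft : (t * toSplit G u x * t⁻¹).left ≠ 1 := fun h1 => by
    refine hx (conjInto_of_toSplit_conj (t := t) (k := (t * toSplit G u x * t⁻¹).right) ?_)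
    ext <;> simp only [h1, left_inr, right_inr]
  obtain ⟨s, hs⟩ := exists_conj_mem_of_commute_inr hcomm hleft
  intro w hw
  have h3 := ex_of_mem_par (v := w) hw hs
  have h4 := congrArg (fun g => ex (fromSplit G u g) w) hk
  simp only [map_mul, map_inv, map_zpow, fromSplit_toSplit, fromSplit_inr] at h4
  simp at h3 h4
  omega

/-- The centralizer of a generator is the parabolic subgroup of its star. -/
lemma mem_par_star_of_commute [Finite V] {v : V} {g : RAAG G} (h : Commute g (gen G v)) :
    g ∈ par (star G v) := by
  refine mem_par_of_forall fun u hu => ?_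
  have huv : v ≠ u := fun h => hu (h ▸ Set.mem_insert _ _)
  refine (mem_par_or_of_commute (gen_mem_par (by simpa using huv)) h).resolve_right ?_
  rintro ⟨t, ht⟩
  have := ex_of_mem_par (v := v)
    (fun h : G.Adj u v => hu (Set.mem_insert_of_mem _ h.symm)) ht
  simp at this

lemma commute_gen_iff [Finite V] {v : V} {g : RAAG G} :
    Commute g (gen G v) ↔ g ∈ par (star G v) :=
  ⟨mem_par_star_of_commute, commute_gen_of_mem_par_star⟩

lemma ConjInto.inter {x : RAAG G} {S T : Set V} (hS : ConjInto x S) (hT : ConjInto x T) :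
    ConjInto x (S ∩ T) := by
  obtain ⟨s, hs⟩ := hS
  obtain ⟨t, ht⟩ := hT
  have h1 : t * x * t⁻¹ = ret T (t * s⁻¹) * ret T (s * x * s⁻¹) * (ret T (t * s⁻¹))⁻¹ := by
    rw [← map_inv, ← map_mul, ← map_mul]
    conv_lhs => rw [← mem_par.mp ht]
    congr 1
    group
  refine ⟨(ret T (t * s⁻¹))⁻¹ * t, ?_⟩
  have h2 := ret_mem_par_inter (S := T) hs
  have h3 : (ret T (t * s⁻¹))⁻¹ * t * x * ((ret T (t * s⁻¹))⁻¹ * t)⁻¹ =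
      ret T (s * x * s⁻¹) := by
    calc _ = (ret T (t * s⁻¹))⁻¹ * (t * x * t⁻¹) * ret T (t * s⁻¹) := by group
      _ = _ := by rw [h1]; group
  rw [h3, Set.inter_comm]
  exact h2

lemma ConjInto.mono {x : RAAG G} {S T : Set V} (h : S ⊆ T) (hS : ConjInto x S) :
    ConjInto x T := by
  obtain ⟨s, hs⟩ := hS
  exact ⟨s, par_mono h hs⟩

lemma conjInto_singleton [Finite V] {x : RAAG G} {u : V} (h : ∀ v ≠ u, ConjInto x {v}ᶜ) :
    ConjInto x {u} := by
  classical
  have := Fintype.ofFinite V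
  have key : ∀ s : Finset V, u ∉ s → ConjInto x (s : Set V)ᶜ := by
    intro s
    induction s using Finset.induction_on with
    | empty => exact fun _ => ⟨1, by simp [mem_par_of_forall]⟩
    | insert a s has ih =>
      intro hu
      rw [Finset.mem_insert, not_or] at hu
      refine ((h a (Ne.symm hu.1)).inter (ih hu.2)).mono ?_
      intro b hb
      simpa using hb
  refine (key {u}ᶜ (by simp)).mono ?_
  simp

/-- Commuting conjugates of two generators. -/
lemma exists_conj_of_commute [Finite V] {v w : V} {g h : RAAG G}
    (hc : Commute (g * gen G v * g⁻¹) (h * gen G w * h⁻¹)) (hvw : v ≠ w) :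
    G.Adj v w ∧ ∃ p, g⁻¹ * p ∈ par (G := G) (star G v) ∧ h⁻¹ * p ∈ par (G := G) (star G w) := by
  set k := g⁻¹ * h with hk
  have h1 : Commute (k * gen G w * k⁻¹) (gen G v) := by
    have := (Commute.conj_iff g⁻¹).mpr hc
    convert this.symm using 1 <;> (try rw [hk]) <;> group
  have h2 := mem_par_star_of_commute h1
  have hw : w ∈ star G v := by
    by_contra hw
    have := ex_of_mem_par hw h2
    simp at this
  refine ⟨hw.resolve_left (Ne.symm hvw), g * ret (star G v) k, by simpa using ret_mem_par _ _, ?_⟩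
  rw [← commute_gen_iff]
  have h3 : k * gen G w * k⁻¹ = ret (star G v) k * gen G w * (ret (star G v) k)⁻¹ := by
    conv_lhs => rw [← mem_par.mp h2]
    simp [ret_gen_of_mem hw]
  rw [mul_inv_eq_iff_eq_mul] at h3
  have h4 : h⁻¹ * (g * ret (star G v) k) = k⁻¹ * ret (star G v) k := by rw [hk]; group
  rw [h4, commute_iff_eq, mul_assoc, inv_mul_eq_iff_eq_mul, ← mul_assoc, ← mul_assoc, h3]
  group

end RAAG

/-! ### Automorphisms permute the conjugacy classes of generators up to inversion -/

namespace RAAG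

variable {V : Type} {G : SimpleGraph V}

/-- The exponent vector of an element. -/
def exVec (g : RAAG G) : V → ℚ := fun w => ex g w

/-- The exponent matrix of an automorphism. -/
def exMat (φ : MulAut (RAAG G)) : Matrix V V ℤ := Matrix.of fun v w => ex (φ (gen G v)) w

/-- The span of the exponent vectors of the centralizer of an element. -/
def centSpan (x : RAAG G) : Submodule ℚ (V → ℚ) :=
  Submodule.span ℚ (exVec '' {y | Commute x y})

open scoped Classical in
/-- The vectors supported in the link of `u`. -/
def linkSpan (G : SimpleGraph V) (u : V) : Submodule ℚ (V → ℚ) :=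
  Submodule.span ℚ (Set.range fun w : G.neighborSet u => Pi.single (w : V) 1)

lemma apply_eq_zero_of_mem_linkSpan {u w : V} {f : V → ℚ} (hf : f ∈ linkSpan G u)
    (hw : ¬G.Adj u w) : f w = 0 := by
  classical
  have : linkSpan G u ≤ LinearMap.ker (LinearMap.proj (R := ℚ) (φ := fun _ : V => ℚ) w) := by
    refine Submodule.span_le.mpr ?_
    rintro _ ⟨⟨x, hx⟩, rfl⟩
    have : x ≠ w := fun h => hw (h ▸ hx)
    simp [this.symm]
  exact this hf

open scoped Classical in
lemma single_mem_linkSpan {u w : V} (hw : G.Adj u w) :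
    (Pi.single w 1 : V → ℚ) ∈ linkSpan G u :=
  Submodule.subset_span ⟨⟨w, hw⟩, by congr⟩

lemma exists_of_mem_span_sup {m f : V → ℚ} {u : V}
    (hf : f ∈ Submodule.span ℚ {m} ⊔ linkSpan G u) :
    ∃ a : ℚ, ∀ w, ¬G.Adj u w → f w = a * m w := by
  obtain ⟨y, hy, z, hz, rfl⟩ := Submodule.mem_sup.mp hf
  obtain ⟨a, rfl⟩ := Submodule.mem_span_singleton.mp hy
  exact ⟨a, fun w hw => by simp [apply_eq_zero_of_mem_linkSpan hz hw]⟩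

lemma exMat_one [DecidableEq V] : exMat (1 : MulAut (RAAG G)) = 1 := by
  ext v w
  simp [exMat, ex_gen, Matrix.one_apply]

lemma not_conjInto_of_ex_ne_zero {x : RAAG G} {u : V} (h : ex x u ≠ 0) : ¬ConjInto x {u}ᶜ := by
  rintro ⟨t, ht⟩
  have := ex_of_mem_par (v := u) (by simp) ht
  rw [ex_conj] at this
  exact h this

variable [Fintype V]

lemma mem_linkSpan {u : V} {f : V → ℚ} (h : ∀ w, ¬G.Adj u w → f w = 0) : f ∈ linkSpan G u := by
  classical
  have : f = ∑ w, f w • (Pi.single w 1 : V → ℚ) := by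
    ext v
    simp [Pi.single_apply]
  rw [this]
  refine Submodule.sum_mem _ fun w _ => ?_
  by_cases hw : G.Adj u w
  · exact Submodule.smul_mem _ _ (single_mem_linkSpan hw)
  · rw [h w hw, zero_smul]
    exact Submodule.zero_mem _

lemma centSpan_le {x : RAAG G} {u : V} (h : ¬ConjInto x {u}ᶜ) :
    centSpan x ≤ Submodule.span ℚ {exVec x} ⊔ linkSpan G u := by
  refine Submodule.span_le.mpr ?_
  rintro _ ⟨y, hy, rfl⟩
  obtain ⟨a, b, hb, hab⟩ := exists_ex_eq_zero_of_commute hy h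
  have hb' : (b : ℚ) ≠ 0 := by exact_mod_cast hb
  refine Submodule.mem_sup.mpr ⟨(-a / b : ℚ) • exVec x,
    Submodule.smul_mem _ _ (Submodule.mem_span_singleton_self _),
    exVec y - (-a / b : ℚ) • exVec x, mem_linkSpan fun w hw => ?_, by simp⟩
  have : (a : ℚ) * ex x w + b * ex y w = 0 := by exact_mod_cast hab w hw
  simp only [Pi.sub_apply, Pi.smul_apply, exVec, smul_eq_mul]
  field_simp
  linarith

lemma ex_apply (φ : MulAut (RAAG G)) (g : RAAG G) (w : V) :
    ex (φ g) w = ∑ v, ex g v * exMat φ v w := by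
  classical
  let F : RAAG G →* Multiplicative ℤ :=
    { toFun := fun g => Multiplicative.ofAdd (∑ v, ex g v * exMat φ v w)
      map_one' := by simp
      map_mul' := fun a b => by simp [add_mul, Finset.sum_add_distrib] }
  have : (expHom w).comp φ.toMonoidHom = F := hom_ext fun v => by
    change Multiplicative.ofAdd (ex (φ (gen G v)) w) = Multiplicative.ofAdd _
    simp [ex_gen, exMat]
  exact congrArg Multiplicative.toAdd (DFunLike.congr_fun this g)

lemma exMat_mul (φ ψ : MulAut (RAAG G)) : exMat (φ * ψ) = exMat ψ * exMat φ := by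
  ext v w
  rw [Matrix.mul_apply]
  exact ex_apply φ (ψ (gen G v)) w

section

variable [DecidableEq V]

lemma exMat_mul_exMat_inv (φ : MulAut (RAAG G)) : exMat φ * exMat φ⁻¹ = 1 := by
  rw [← exMat_mul, inv_mul_cancel, exMat_one]

lemma linearIndependent_exVec (φ : MulAut (RAAG G)) :
    LinearIndependent ℚ fun v => exVec (φ (gen G v)) := by
  have h : IsUnit ((exMat φ).map (Int.castRingHom ℚ)) := by
    refine IsUnit.map (Int.castRingHom ℚ).mapMatrix ?_
    exact Matrix.isUnit_iff_isUnit_det _ |>.mpr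
      (Matrix.isUnit_det_of_right_inverse (exMat_mul_exMat_inv φ))
  exact Matrix.linearIndependent_rows_iff_isUnit.mpr h

lemma exists_perm_ex_ne_zero (φ : MulAut (RAAG G)) :
    ∃ σ : Equiv.Perm V, ∀ v, ex (φ (gen G v)) (σ v) ≠ 0 := by
  have h : (exMat φ).det ≠ 0 :=
    (Matrix.isUnit_det_of_right_inverse (exMat_mul_exMat_inv φ)).ne_zero
  rw [Matrix.det_apply] at h
  obtain ⟨σ, -, hσ⟩ := Finset.exists_ne_zero_of_sum_ne_zero h
  refine ⟨σ⁻¹, fun v hv => hσ ?_⟩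
  rw [Finset.prod_eq_zero (Finset.mem_univ (σ⁻¹ v)), smul_zero]
  simpa [exMat] using hv

end

lemma finrank_linkSpan_le (u : V) :
    Module.finrank ℚ (linkSpan G u) ≤ Nat.card (G.neighborSet u) := by
  classical
  rw [Nat.card_eq_fintype_card]
  exact finrank_range_le_card _

lemma card_lt_finrank_centSpan (φ : MulAut (RAAG G)) (v : V) :
    Nat.card (G.neighborSet v) + 1 ≤ Module.finrank ℚ (centSpan (φ (gen G v))) := by
  classical
  have h1 := (linearIndependent_exVec φ).comp (Subtype.val : star G v → V) Subtype.val_injective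
  have h2 := finrank_span_eq_card h1
  have h3 : Fintype.card (star G v) = Nat.card (G.neighborSet v) + 1 := by
    rw [← Nat.card_eq_fintype_card, Nat.card_coe_set_eq, Nat.card_coe_set_eq,
      show star G v = insert v (G.neighborSet v) from rfl,
      Set.ncard_insert_of_notMem (by simp)]
  rw [← h3, ← h2]
  refine Submodule.finrank_mono (Submodule.span_mono ?_)
  rintro _ ⟨⟨w, hw⟩, rfl⟩
  refine ⟨φ (gen G w), ?_, rfl⟩
  exact ((commute_gen_of_mem_par_star (gen_mem_par hw)).map φ.toMonoidHom).symm

lemma linkSpan_le_centSpan {φ : MulAut (RAAG G)} {σ : Equiv.Perm V}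
    (hσ : ∀ v, ex (φ (gen G v)) (σ v) ≠ 0) (v : V) :
    linkSpan G (σ v) ≤ centSpan (φ (gen G v)) := by
  have hle : ∀ v, centSpan (φ (gen G v)) ≤
      Submodule.span ℚ {exVec (φ (gen G v))} ⊔ linkSpan G (σ v) :=
    fun v => centSpan_le (not_conjInto_of_ex_ne_zero (hσ v))
  have hrank : ∀ v, Module.finrank ℚ
      (Submodule.span ℚ {exVec (φ (gen G v))} ⊔ linkSpan G (σ v) : Submodule ℚ (V → ℚ)) ≤
      Nat.card (G.neighborSet (σ v)) + 1 := fun v => by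
    have h1 := Submodule.finrank_add_le_finrank_add_finrank
      (Submodule.span ℚ {exVec (φ (gen G v))}) (linkSpan G (σ v))
    have h2 : Module.finrank ℚ (Submodule.span ℚ {exVec (φ (gen G v))}) ≤ 1 := by
      simpa using finrank_span_le_card ({exVec (φ (gen G v))} : Set (V → ℚ))
    have h3 := finrank_linkSpan_le (G := G) (σ v)
    omega
  have hdeg : ∀ v, Nat.card (G.neighborSet v) ≤ Nat.card (G.neighborSet (σ v)) := fun v => by
    have h1 := card_lt_finrank_centSpan φ v
    have h2 := Submodule.finrank_mono (hle v)
    have h3 := hrank v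
    omega
  have heq := (Finset.sum_eq_sum_iff_of_le (s := Finset.univ) fun v _ => hdeg v).mp
    (Equiv.sum_comp σ fun v => Nat.card (G.neighborSet v)).symm
  have h : centSpan (φ (gen G v)) = _ := Submodule.eq_of_le_of_finrank_le (hle v) (by
    have h1 := card_lt_finrank_centSpan φ v
    have h2 := hrank v
    have h3 := heq v (Finset.mem_univ v)
    omega)
  rw [h]
  exact le_sup_right

lemma conjInto_compl_of_ne (hdom : ∀ u v : V, u ≠ v → ¬Dominates G u v)
    {φ : MulAut (RAAG G)} {σ : Equiv.Perm V} (hσ : ∀ v, ex (φ (gen G v)) (σ v) ≠ 0)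
    {u v : V} (hu : u ≠ σ v) : ConjInto (φ (gen G v)) {u}ᶜ := by
  classical
  by_contra hx
  have hle := (linkSpan_le_centSpan hσ v).trans (centSpan_le hx)
  have hv : exVec (φ (gen G v)) (σ v) ≠ 0 := by
    have := hσ v
    unfold exVec
    exact_mod_cast this
  refine hdom _ _ hu fun w hw => ?_
  by_contra hw'
  obtain ⟨a, ha⟩ := exists_of_mem_span_sup (hle (single_mem_linkSpan hw))
  have hwu : w ≠ u := fun h => hw' (h ▸ Set.mem_insert _ _)
  have h1 := ha w fun h => hw' (Set.mem_insert_of_mem _ h)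
  rw [Pi.single_eq_same] at h1
  have ha0 : a ≠ 0 := fun h => by simp [h] at h1
  by_cases huv : G.Adj u (σ v)
  · have h2 := ha u (G.loopless.irrefl u)
    rw [Pi.single_eq_of_ne hwu.symm] at h2
    obtain ⟨b, hb⟩ := exists_of_mem_span_sup (hle (single_mem_linkSpan huv.symm))
    have h3 := hb u (G.loopless.irrefl u)
    rw [Pi.single_eq_same] at h3
    rcases mul_eq_zero.mp h2.symm with h | h
    · exact ha0 h
    · simp [h] at h3
  · have h2 := ha _ huv
    rw [Pi.single_eq_of_ne (G.ne_of_adj hw)] at h2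
    exact mul_ne_zero ha0 hv h2.symm

lemma adj_apply_of_commute {v w : V} {g h : RAAG G} {ε δ : ℤˣ} (hvw : v ≠ w)
    (hc : Commute (g * gen G v ^ (ε : ℤ) * g⁻¹) (h * gen G w ^ (δ : ℤ) * h⁻¹)) :
    G.Adj v w ∧ ∃ p, g⁻¹ * p ∈ par (G := G) (star G v) ∧ h⁻¹ * p ∈ par (G := G) (star G w) := by
  refine exists_conj_of_commute ?_ hvw
  rw [← conj_zpow, ← conj_zpow] at hc
  rcases Int.units_eq_one_or ε with rfl | rfl <;> rcases Int.units_eq_one_or δ with rfl | rfl <;>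
    simpa [-mul_inv_rev, Commute.inv_left_iff, Commute.inv_right_iff] using hc

/-- In the absence of domination and of graph automorphisms, every automorphism sends each
generator to a conjugate of itself or its inverse. -/
theorem exists_apply_gen_eq_conj (hdom : ∀ u v : V, u ≠ v → ¬Dominates G u v)
    (hT : TrivialAut G) (φ : MulAut (RAAG G)) (v : V) :
    ∃ (g : RAAG G) (ε : ℤˣ), φ (gen G v) = g * gen G v ^ (ε : ℤ) * g⁻¹ := by
  classical
  obtain ⟨σ, hσ⟩ := exists_perm_ex_ne_zero φ
  have key : ∀ v, ∃ (g : RAAG G) (ε : ℤˣ), φ (gen G v) = g * gen G (σ v) ^ (ε : ℤ) * g⁻¹ := by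
    intro v
    obtain ⟨t, ht⟩ := conjInto_singleton fun u (hu : u ≠ σ v) => conjInto_compl_of_ne hdom hσ hu
    obtain ⟨k, hk⟩ := eq_zpow_of_mem_par_singleton ht
    have hφ : φ (gen G v) = t⁻¹ * gen G (σ v) ^ k * t := by rw [← hk]; group
    have h1 := congrFun (congrFun (exMat_mul_exMat_inv φ) v) v
    rw [Matrix.mul_apply, Matrix.one_apply_eq, Finset.sum_eq_single (σ v)] at h1
    · have h2 : exMat φ v (σ v) = k := by simp [exMat, hφ]
      rw [h2] at h1
      refine ⟨t⁻¹, (IsUnit.of_mul_eq_one _ h1).unit, ?_⟩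
      simp [hφ]
    · intro w _ hw
      simp [exMat, hφ, ex_gen_of_ne hw.symm]
    · simp
  have hadj : ∀ {v w}, G.Adj v w → G.Adj (σ v) (σ w) := by
    intro v w h
    obtain ⟨g, ε, hg⟩ := key v
    obtain ⟨k, δ, hk⟩ := key w
    have hc : Commute (φ (gen G v)) (φ (gen G w)) := (gen_commute h).map φ.toMonoidHom
    rw [hg, hk] at hc
    exact (adj_apply_of_commute (σ.injective.ne h.ne) hc).1
  have hpow : ∀ (k : ℕ) {v w}, G.Adj v w → G.Adj ((σ ^ k) v) ((σ ^ k) w) := by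
    intro k
    induction k with
    | zero => exact fun h => h
    | succ k ih =>
      intro v w h
      rw [pow_succ]
      exact ih (hadj h)
  have hσ1 := hT ⟨σ, fun {v w} => ⟨fun h => by
    have h1 := hpow (orderOf σ - 1) h
    have h2 : σ ^ (orderOf σ - 1) * σ = 1 := by
      rw [← pow_succ, Nat.sub_add_cancel (orderOf_pos σ), pow_orderOf_eq_one]
    simpa [← Equiv.Perm.mul_apply, h2] using h1, hadj⟩⟩ v
  have := key v
  rwa [show σ v = v from hσ1] at this

end RAAG

/-! ### Conjugating automorphisms of a graph with a hub -/

namespace RAAG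

/-- The combinatorial conditions on a hub `c` under which every automorphism of the right-angled
Artin group is, up to inner automorphisms and inversions, a product of partial conjugations by `c`.
The components of the complement of the star of `c` are labelled by `Option ι`. -/
structure IsHub {V ι : Type} (G : SimpleGraph V) (c : V) (lab : V → Option ι) : Prop where
  not_dominates : ∀ u v : V, u ≠ v → ¬Dominates G u v
  trivialAut : TrivialAut G
  connected : ∀ u, u ≠ c → (G.induce (star G u)ᶜ).Connected
  lab_eq_none : ∀ v ∈ star G c, lab v = none
  lab_eq_of_adj : ∀ v w, v ∉ star G c → w ∉ star G c → G.Adj v w → lab v = lab w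
  reachable : ∀ v w : ((star G c)ᶜ : Set V), lab v = lab w →
    (G.induce (star G c)ᶜ).Reachable v w
  exists_notMem : ∀ i u u', ∃ v, lab v = i ∧ v ∉ star G c ∧ v ∉ star G u ∧ v ∉ star G u'

variable {V ι : Type} {G : SimpleGraph V} {c : V} {lab : V → Option ι}

lemma mem_star_comm {u v : V} : u ∈ star G v ↔ v ∈ star G u := by
  change (u = v ∨ G.Adj v u) ↔ (v = u ∨ G.Adj u v)
  rw [G.adj_comm, eq_comm]

lemma mem_par_compl_of_notMem_star {u v : V} (h : v ∉ star G u) {g : RAAG G}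
    (hg : g ∈ par (star G v)) : g ∈ par {u}ᶜ := by
  refine par_mono ?_ hg
  rw [Set.subset_compl_singleton_iff]
  exact fun h' => h (mem_star_comm.mp h')

lemma mem_par_singleton_of_forall [Finite V] (hdom : ∀ u v : V, u ≠ v → ¬Dominates G u v)
    {g : RAAG G} (h : ∀ v ∈ star G c, g ∈ par (star G v)) : g ∈ par {c} := by
  refine mem_par_of_forall fun w hw => ?_
  obtain ⟨v, hv, hvw⟩ := Set.not_subset.mp (hdom w c hw)
  exact mem_par_compl_of_notMem_star hvw (h v (Set.mem_insert_of_mem _ hv))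

lemma inv_mul_mem_par_of_reachable [Finite V] {ψ : RAAG G →* RAAG G} {g : V → RAAG G}
    (hg : ∀ v, ψ (gen G v) = g v * gen G v * (g v)⁻¹) {u : V} {v w : ((star G u)ᶜ : Set V)}
    (h : (G.induce (star G u)ᶜ).Reachable v w) : (g v)⁻¹ * g w ∈ par {u}ᶜ := by
  obtain ⟨p⟩ := h
  induction p with
  | nil => simp
  | @cons a b d hab _ ih =>
    have hadj : G.Adj a b := hab
    have hc := (gen_commute hadj).map ψ
    rw [hg, hg] at hc
    obtain ⟨-, p, hp, hp'⟩ := exists_conj_of_commute hc hadj.ne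
    have h1 := mul_mem (mul_mem (mem_par_compl_of_notMem_star a.2 hp)
      (inv_mem (mem_par_compl_of_notMem_star b.2 hp'))) ih
    convert h1 using 1
    group

lemma IsHub.exists_common_conj [Finite V] (hub : IsHub G c lab) {ψ : RAAG G →* RAAG G}
    {g : V → RAAG G} (hg : ∀ v, ψ (gen G v) = g v * gen G v * (g v)⁻¹) (i : Option ι) :
    ∃ p, ∀ v, (v ∉ star G c → lab v = i) → (g v)⁻¹ * p ∈ par (star G v) := by
  have := Fintype.ofFinite V
  have key : ∀ u v w, v ∉ star G u → w ∉ star G u → (v ∉ star G c → lab v = i) →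
      (w ∉ star G c → lab w = i) → (g v)⁻¹ * g w ∈ par {u}ᶜ := by
    intro u v w hv hw hvi hwi
    refine inv_mul_mem_par_of_reachable hg (v := ⟨v, hv⟩) (w := ⟨w, hw⟩) ?_
    by_cases huc : u = c
    · subst huc
      exact hub.reachable _ _ ((hvi hv).trans (hwi hw).symm)
    · exact (hub.connected u huc).preconnected _ _
  choose r hri hrc hru hru' using fun u => hub.exists_notMem i u u
  obtain ⟨p, hp⟩ := helly Finset.univ (fun u => g (r u)) (fun u => {u}ᶜ) fun u _ u' _ => by
    obtain ⟨v, hvi, hvc, hvu, hvu'⟩ := hub.exists_notMem i u u'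
    exact ⟨g v, key u _ _ (hru u) hvu (fun _ => hri u) fun _ => hvi,
      key u' _ _ (hru u') hvu' (fun _ => hri u') fun _ => hvi⟩
  refine ⟨p, fun v hv => mem_par_of_forall fun u hu => ?_⟩
  have h1 := mul_mem (key u v (r u) (fun h => hu (mem_star_comm.mp h)) (hru u) hv fun _ => hri u)
    (hp u (Finset.mem_univ _))
  convert h1 using 1
  group

/-- The exponent of `c` attached to a vertex by a function on the labels. -/
def hubExp (lab : V → Option ι) (k : ι → ℤ) (v : V) : ℤ := (lab v).elim 0 k

theorem IsHub.exists_conj [Finite V] (hub : IsHub G c lab) {ψ : RAAG G →* RAAG G}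
    {g : V → RAAG G} (hg : ∀ v, ψ (gen G v) = g v * gen G v * (g v)⁻¹) :
    ∃ p k, ∀ v, ψ (gen G v) =
      p * (gen G c ^ hubExp lab k v * gen G v * (gen G c ^ hubExp lab k v)⁻¹) * p⁻¹ := by
  choose p hp using fun i => hub.exists_common_conj hg i
  have h1 : ∀ i, ∃ m : ℤ, (p none)⁻¹ * p i = gen G c ^ m := fun i => by
    refine eq_zpow_of_mem_par_singleton (mem_par_singleton_of_forall hub.not_dominates ?_)
    intro v hv
    have h := mul_mem (inv_mem (hp none v fun h => absurd hv h)) (hp i v fun h => absurd hv h)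
    convert h using 1
    group
  choose m hm using h1
  refine ⟨p none, fun i => m (some i), fun v => ?_⟩
  have h2 : gen G c ^ hubExp lab (fun i => m (some i)) v = (p none)⁻¹ * p (lab v) := by
    unfold hubExp
    cases lab v with
    | none => simp
    | some i => exact (hm _).symm
  have h3 := (commute_gen_of_mem_par_star (hp (lab v) v fun _ => rfl)).eq
  rw [hg, h2]
  have h4 : gen G v = (g v)⁻¹ * p (lab v) * gen G v * ((g v)⁻¹ * p (lab v))⁻¹ := by
    rw [h3]; group
  conv_lhs => rw [h4]
  group

/-! ### The outer automorphism group of a graph with a hub -/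

/-- The group of partial conjugations by `c` and inversions. -/
@[ext]
structure HubGroup (V ι : Type) (c : V) where
  /-- The exponents of the partial conjugations. -/
  exps : ι → ℤ
  /-- The signs of the inversions. -/
  signs : V → ℤˣ

namespace HubGroup

instance : Mul (HubGroup V ι c) :=
  ⟨fun a b => ⟨fun i => a.exps i + a.signs c * b.exps i, fun v => a.signs v * b.signs v⟩⟩

instance : One (HubGroup V ι c) := ⟨⟨fun _ => 0, fun _ => 1⟩⟩

instance : Inv (HubGroup V ι c) := ⟨fun a => ⟨fun i => -(a.signs c * a.exps i), fun v => a.signs v⟩⟩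

@[simp] lemma mul_exps (a b : HubGroup V ι c) (i : ι) :
    (a * b).exps i = a.exps i + a.signs c * b.exps i := rfl
@[simp] lemma mul_signs (a b : HubGroup V ι c) (v : V) :
    (a * b).signs v = a.signs v * b.signs v := rfl
@[simp] lemma one_exps (i : ι) : (1 : HubGroup V ι c).exps i = 0 := rfl
@[simp] lemma one_signs (v : V) : (1 : HubGroup V ι c).signs v = 1 := rfl
@[simp] lemma inv_exps (a : HubGroup V ι c) (i : ι) :
    a⁻¹.exps i = -(a.signs c * a.exps i) := rfl
@[simp] lemma inv_signs (a : HubGroup V ι c) (v : V) : a⁻¹.signs v = a.signs v := rfl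

instance : Group (HubGroup V ι c) :=
  Group.ofLeftAxioms
    (fun a b d => by ext <;> simp <;> ring)
    (fun a => by ext <;> simp)
    (fun a => by ext <;> simp)

end HubGroup

lemma hubExp_mul (a b : HubGroup V ι c) (v : V) :
    hubExp lab (a * b).exps v = hubExp lab a.exps v + a.signs c * hubExp lab b.exps v := by
  unfold hubExp
  cases lab v <;> simp

lemma hubExp_one (v : V) : hubExp lab (1 : HubGroup V ι c).exps v = 0 := by
  unfold hubExp
  cases lab v <;> simp

lemma IsHub.hubExp_of_mem (hub : IsHub G c lab) {v : V} (hv : v ∈ star G c) (k : ι → ℤ) :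
    hubExp lab k v = 0 := by
  simp [hubExp, hub.lab_eq_none v hv]

/-- The image of a generator under a product of partial conjugations and inversions. -/
def hubGen (G : SimpleGraph V) (lab : V → Option ι) (a : HubGroup V ι c) (v : V) : RAAG G :=
  gen G c ^ hubExp lab a.exps v * gen G v ^ (a.signs v : ℤ) * (gen G c ^ hubExp lab a.exps v)⁻¹

lemma IsHub.commute_hubGen (hub : IsHub G c lab) (a : HubGroup V ι c) {v w : V}
    (h : G.Adj v w) : Commute (hubGen G lab a v) (hubGen G lab a w) := by
  have hstar : ∀ v ∈ star G c, ∀ k : ℤ,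
      gen G c ^ k * gen G v ^ (a.signs v : ℤ) * (gen G c ^ k)⁻¹ = gen G v ^ (a.signs v : ℤ) := by
    intro v hv k
    rw [mul_inv_eq_iff_eq_mul]
    exact ((commute_gen_of_mem_par_star (gen_mem_par hv)).symm.zpow_zpow _ _).eq
  have hconj : ∀ k : ℤ, Commute (gen G c ^ k * gen G v ^ (a.signs v : ℤ) * (gen G c ^ k)⁻¹)
      (gen G c ^ k * gen G w ^ (a.signs w : ℤ) * (gen G c ^ k)⁻¹) := fun k =>
    (Commute.conj_iff _).mpr ((gen_commute h).zpow_zpow _ _)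
  unfold hubGen
  by_cases hv : v ∈ star G c
  · have := hconj (hubExp lab a.exps w)
    rw [hstar v hv] at this
    rwa [hstar v hv]
  by_cases hw : w ∈ star G c
  · have := hconj (hubExp lab a.exps v)
    rw [hstar w hw] at this
    rwa [hstar w hw]
  have : hubExp lab a.exps w = hubExp lab a.exps v := by
    rw [hubExp, hubExp, hub.lab_eq_of_adj v w hv hw h]
  rw [this]
  exact hconj _

/-- The endomorphism given by an element of the hub group. -/
def IsHub.hom (hub : IsHub G c lab) (a : HubGroup V ι c) : RAAG G →* RAAG G :=
  lift (hubGen G lab a) fun _ _ => hub.commute_hubGen a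

lemma IsHub.hom_gen (hub : IsHub G c lab) (a : HubGroup V ι c) (v : V) :
    hub.hom a (gen G v) = gen G c ^ hubExp lab a.exps v * gen G v ^ (a.signs v : ℤ) *
      (gen G c ^ hubExp lab a.exps v)⁻¹ :=
  lift_gen _ _ _

lemma IsHub.hom_mul (hub : IsHub G c lab) (a b : HubGroup V ι c) :
    hub.hom (a * b) = (hub.hom a).comp (hub.hom b) := hom_ext fun v => by
  have hc : hub.hom a (gen G c) = gen G c ^ (a.signs c : ℤ) := by
    rw [hub.hom_gen, hub.hubExp_of_mem (Set.mem_insert _ _)]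
    simp
  rw [MonoidHom.comp_apply, hub.hom_gen b, map_mul, map_mul, map_inv, map_zpow, map_zpow, hc,
    hub.hom_gen, hub.hom_gen, conj_zpow, hubExp_mul, HubGroup.mul_signs, Units.val_mul, zpow_mul,
    zpow_add, zpow_mul]
  group

lemma IsHub.hom_one (hub : IsHub G c lab) : hub.hom 1 = MonoidHom.id _ := hom_ext fun v => by
  rw [hub.hom_gen, hubExp_one]
  simp

/-- The action of the hub group by automorphisms. -/
def IsHub.aut (hub : IsHub G c lab) : HubGroup V ι c →* MulAut (RAAG G) where
  toFun a := MonoidHom.toMulEquiv (hub.hom a) (hub.hom a⁻¹)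
    (by rw [← hub.hom_mul, inv_mul_cancel, hub.hom_one])
    (by rw [← hub.hom_mul, mul_inv_cancel, hub.hom_one])
  map_one' := by
    ext x
    exact DFunLike.congr_fun hub.hom_one x
  map_mul' a b := by
    ext x
    exact DFunLike.congr_fun (hub.hom_mul a b) x

lemma IsHub.aut_gen (hub : IsHub G c lab) (a : HubGroup V ι c) (v : V) :
    hub.aut a (gen G v) = gen G c ^ hubExp lab a.exps v * gen G v ^ (a.signs v : ℤ) *
      (gen G c ^ hubExp lab a.exps v)⁻¹ :=
  hub.hom_gen a v

/-- The homomorphism from the hub group to outer automorphisms. -/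
def IsHub.out (hub : IsHub G c lab) : HubGroup V ι c →* Out (RAAG G) :=
  (QuotientGroup.mk' (Inn (RAAG G))).comp hub.aut

lemma IsHub.out_injective [Finite V] (hub : IsHub G c lab) : Function.Injective hub.out := by
  rw [injective_iff_map_eq_one]
  intro a ha
  obtain ⟨g, hg⟩ := (QuotientGroup.eq_one_iff _).mp ha
  replace hg : ∀ v, g * gen G v * g⁻¹ = hub.aut a (gen G v) := fun v => by
    rw [← hg, MulAut.conj_apply]
  have hs : ∀ v, a.signs v = 1 := fun v => by
    have h := congrArg (fun x => ex x v) (hg v)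
    simp [hub.aut_gen, ex_gen] at h
    exact Units.ext h.symm
  simp only [hub.aut_gen, hs, Units.val_one, zpow_one] at hg
  have hgc : g ∈ par {c} := mem_par_singleton_of_forall hub.not_dominates fun v hv => by
    have h := hg v
    rw [hub.hubExp_of_mem hv] at h
    rw [← commute_gen_iff, commute_iff_eq, ← mul_inv_eq_iff_eq_mul, h]
    simp
  obtain ⟨m, rfl⟩ := eq_zpow_of_mem_par_singleton hgc
  have hm : ∀ v ∉ star G c, m = hubExp lab a.exps v := fun v hv => by
    have h : Commute (gen G c ^ (m - hubExp lab a.exps v)) (gen G v) := by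
      have h := hg v
      rw [mul_inv_eq_iff_eq_mul] at h
      rw [sub_eq_neg_add, zpow_add, zpow_neg, commute_iff_eq, mul_assoc, inv_mul_eq_iff_eq_mul, h]
      group
    have h2 := ex_of_mem_par (v := c) (fun h => hv (mem_star_comm.mp h))
      (mem_par_star_of_commute h)
    simp at h2
    omega
  have hm' : ∀ i : Option ι, m = i.elim 0 a.exps := fun i => by
    obtain ⟨v, rfl, hv, -⟩ := hub.exists_notMem i c c
    exact hm v hv
  ext i
  · rw [HubGroup.one_exps, ← show m = 0 from hm' none]
    exact (hm' (some i)).symm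
  · rw [hs, HubGroup.one_signs]

lemma IsHub.out_surjective [Finite V] (hub : IsHub G c lab) : Function.Surjective hub.out := by
  have := Fintype.ofFinite V
  intro x
  obtain ⟨φ, rfl⟩ := QuotientGroup.mk'_surjective _ x
  choose g ε hg using exists_apply_gen_eq_conj hub.not_dominates hub.trivialAut φ
  let b : HubGroup V ι c := ⟨fun _ => 0, ε⟩
  have hb : ∀ v, (φ * hub.aut b) (gen G v) = g v * gen G v * (g v)⁻¹ := fun v => by
    have h0 : hubExp lab b.exps v = 0 := hubExp_one (c := c) v
    rw [MulAut.mul_apply, hub.aut_gen, h0, zpow_zero, one_mul, inv_one, mul_one, map_zpow, hg,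
      conj_zpow, ← zpow_mul, ← Units.val_mul, show b.signs v = ε v from rfl, Int.units_mul_self,
      Units.val_one, zpow_one]
  obtain ⟨p, k, hk⟩ := hub.exists_conj (ψ := (φ * hub.aut b).toMonoidHom) hb
  let d : HubGroup V ι c := ⟨k, fun _ => 1⟩
  have h1 : φ * hub.aut b = MulAut.conj p * hub.aut d := by
    refine MulEquiv.toMonoidHom_injective (hom_ext fun v => ?_)
    rw [hk]
    simp [hub.aut_gen, d]
  refine ⟨d * b⁻¹, ?_⟩
  have h2 : QuotientGroup.mk' (Inn (RAAG G)) (MulAut.conj p) = 1 :=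
    (QuotientGroup.eq_one_iff _).mpr ⟨p, rfl⟩
  have h3 := congrArg (QuotientGroup.mk' (Inn (RAAG G))) h1
  rw [map_mul, map_mul, h2, one_mul] at h3
  rw [map_mul, map_inv, mul_inv_eq_iff_eq_mul]
  exact h3.symm

/-- The outer automorphism group of a graph with a hub. -/
def IsHub.outEquiv [Finite V] (hub : IsHub G c lab) : HubGroup V ι c ≃* Out (RAAG G) :=
  MulEquiv.ofBijective hub.out ⟨hub.out_injective, hub.out_surjective⟩

end RAAG

/-! ### Linear groups acting on the hub group -/

lemma mulAutCongr_mem_Inn {E E' : Type} [Group E] [Group E'] (e : E ≃* E') {φ : MulAut E} :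
    MulAut.congr e φ ∈ Inn E' ↔ φ ∈ Inn E := by
  constructor
  · rintro ⟨g, hg⟩
    refine ⟨e.symm g, ?_⟩
    ext x
    have := DFunLike.congr_fun hg (e x)
    simp only [MulAut.conj_apply, MulAut.congr_apply, MulEquiv.trans_apply,
      MulEquiv.symm_apply_apply] at this
    apply e.injective
    simp [← this]
  · rintro ⟨g, rfl⟩
    refine ⟨e g, ?_⟩
    ext x
    simp

namespace RAAG

variable {V : Type} {c : V} {n : ℕ}

open Matrix

/-- The linear action on the exponents of the partial conjugations. -/
def linearAut (V : Type) (c : V) (n : ℕ) : GLZ n →* MulAut (HubGroup V (Fin n) c) where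
  toFun M :=
    { toFun := fun a => ⟨M.val *ᵥ a.exps, a.signs⟩
      invFun := fun a => ⟨(M⁻¹).val *ᵥ a.exps, a.signs⟩
      left_inv := fun a => by
        ext i
        · simp only [mulVec_mulVec, ← Units.val_mul, inv_mul_cancel, Units.val_one, one_mulVec]
        · rfl
      right_inv := fun a => by
        ext i
        · simp only [mulVec_mulVec, ← Units.val_mul, mul_inv_cancel, Units.val_one, one_mulVec]
        · rfl
      map_mul' := fun a b => by
        have : (a * b).exps = a.exps + (a.signs c : ℤ) • b.exps := by
          ext i
          simp
        ext i
        · change (M.val *ᵥ (a * b).exps) i = (M.val *ᵥ a.exps) i + a.signs c * (M.val *ᵥ b.exps) i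
          rw [this, mulVec_add, mulVec_smul]
          rfl
        · rfl }
  map_one' := by
    ext a i
    · exact congrFun (one_mulVec a.exps) i
    · rfl
  map_mul' M N := by
    ext a i
    · exact congrFun (mulVec_mulVec a.exps M.val N.val).symm i
    · rfl

lemma linearAut_exps (M : GLZ n) (a : HubGroup V (Fin n) c) :
    (linearAut V c n M a).exps = M.val *ᵥ a.exps := rfl

lemma linearAut_signs (M : GLZ n) (a : HubGroup V (Fin n) c) :
    (linearAut V c n M a).signs = a.signs := rfl

lemma linearAut_injective : Function.Injective (linearAut V c n) := by
  intro M N h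
  refine Units.ext (Matrix.toLin'.injective (LinearMap.ext fun k => ?_))
  exact congrArg HubGroup.exps (DFunLike.congr_fun h (⟨k, fun _ => 1⟩ : HubGroup V (Fin n) c))

lemma linearAut_mem_Inn (hn : 1 ≤ n) (M : GLZ n) :
    linearAut V c n M ∈ Inn (HubGroup V (Fin n) c) ↔ M ∈ Subgroup.center (GLZ n) := by
  rw [Matrix.GeneralLinearGroup.mem_center_iff_val_mem_range_scalar]
  constructor
  · rintro ⟨g, hg⟩
    refine ⟨g.signs c, Matrix.toLin'.injective (LinearMap.ext fun k => ?_)⟩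
    have := congrArg HubGroup.exps
      (DFunLike.congr_fun hg (⟨k, fun _ => 1⟩ : HubGroup V (Fin n) c))
    rw [linearAut_exps] at this
    rw [toLin'_apply, toLin'_apply, ← this]
    ext i
    simp [MulAut.conj_apply, ← mul_assoc, ← Units.val_mul]
  · rintro ⟨r, hr⟩
    have hunit : IsUnit r := by
      have h := congrFun (congrFun M.mul_inv ⟨0, hn⟩) ⟨0, hn⟩
      rw [← hr, scalar_apply, diagonal_mul, one_apply_eq] at h
      exact IsUnit.of_mul_eq_one _ h
    obtain ⟨u, rfl⟩ := hunit
    refine ⟨⟨fun _ => 0, fun _ => u⟩, ?_⟩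
    ext a i
    · rw [linearAut_exps, ← hr]
      simp [MulAut.conj_apply]
    · rw [linearAut_signs]
      simp [MulAut.conj_apply, mul_right_comm]

theorem IsHub.exists_embeddings [Finite V] {G : SimpleGraph V} {lab : V → Option (Fin n)}
    (hub : IsHub G c lab) (hn : 1 ≤ n) :
    (∃ f : GLZ n →* MulAut (Out (RAAG G)), Function.Injective f) ∧
      (∃ f : PGLZ n →* Out (Out (RAAG G)), Function.Injective f) := by
  let F : GLZ n →* MulAut (Out (RAAG G)) :=
    (MulAut.congr hub.outEquiv).toMonoidHom.comp (linearAut V c n)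
  have hF : ∀ M, F M ∈ Inn (Out (RAAG G)) ↔ M ∈ Subgroup.center (GLZ n) := fun M =>
    (mulAutCongr_mem_Inn hub.outEquiv).trans (linearAut_mem_Inn hn M)
  refine ⟨⟨F, (MulAut.congr hub.outEquiv).injective.comp linearAut_injective⟩,
    QuotientGroup.lift _ ((QuotientGroup.mk' _).comp F) fun M hM =>
      (QuotientGroup.eq_one_iff _).mpr ((hF M).mpr hM), ?_⟩
  rw [injective_iff_map_eq_one]
  intro x hx
  induction x using QuotientGroup.induction_on with
  | H M => exact (QuotientGroup.eq_one_iff _).mpr ((hF M).mp ((QuotientGroup.eq_one_iff _).mp hx))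

end RAAG

/-! ### Wheels with few spokes -/

namespace Wheel

/-- The rim vertices `0, …, m - 1` joined to the hub. -/
def Spoke (n a : ℕ) : Prop := (a % 12 = 0 ∧ a ≤ 12 * n) ∨ a = 1

/-- The cyclic adjacency of the rim vertices `0, …, m - 1`. -/
def Rim (m a b : ℕ) : Prop :=
  a < m ∧ b < m ∧ (a + 1 = b ∨ b + 1 = a ∨ (a = 0 ∧ b + 1 = m) ∨ (b = 0 ∧ a + 1 = m))

/-- Adjacency in the wheel with rim `0, …, m - 1` and hub `m`. -/
def WAdj (n m a b : ℕ) : Prop :=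
  Rim m a b ∨ (a < m ∧ b = m ∧ Spoke n a) ∨ (b < m ∧ a = m ∧ Spoke n b)

variable {n m : ℕ}

lemma wAdj_symm {a b : ℕ} (h : WAdj n m a b) : WAdj n m b a := by
  unfold WAdj Rim Spoke at *
  omega

lemma wAdj_hub {b : ℕ} : WAdj n m m b ↔ b < m ∧ Spoke n b := by
  unfold WAdj Rim Spoke
  omega

lemma wAdj_rim {a b : ℕ} (ha : a < m) :
    WAdj n m a b ↔ Rim m a b ∨ (b = m ∧ Spoke n a) := by
  unfold WAdj Rim Spoke
  omega

/-- The wheel as a graph. -/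
def graph (n m : ℕ) (hm : 2 ≤ m) : SimpleGraph (Fin (m + 1)) where
  Adj a b := WAdj n m a b
  symm := ⟨fun _ _ => wAdj_symm⟩
  loopless := ⟨fun a h => by
    unfold WAdj Rim at h
    omega⟩

lemma exists_wAdj_not (hm : 12 * (n + 1) ≤ m) (hn : 1 ≤ n) {u v : ℕ} (hu : u ≤ m) (hv : v ≤ m)
    (huv : u ≠ v) : ∃ w ≤ m, WAdj n m v w ∧ w ≠ u ∧ ¬WAdj n m u w := by
  rcases hv.lt_or_eq with hv | rfl
  · rcases hu.lt_or_eq with hu | rfl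
    · by_contra! h
      simp only [wAdj_rim hv, wAdj_rim hu, Rim] at h
      have h1 := h (v + 1)
      have h2 := h (v - 1)
      have h3 := h 0
      have h4 := h (m - 1)
      omega
    · by_contra! h
      simp only [wAdj_rim hv, wAdj_hub, Rim, Spoke] at h
      have h1 := h (v + 1)
      have h2 := h (v - 1)
      have h4 := h (u - 1)
      omega
  · replace hu : u < v := by omega
    by_contra! h
    simp only [wAdj_rim hu, wAdj_hub, Rim, Spoke] at h
    have h1 := h 0
    have h2 := h 12
    omega

lemma triangle (hm : 12 * (n + 1) ≤ m) (hn : 1 ≤ n) {a b d : ℕ} (hab : WAdj n m a b)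
    (hbd : WAdj n m b d) (had : WAdj n m a d) :
    (a = 0 ∨ a = 1 ∨ a = m) ∧ (b = 0 ∨ b = 1 ∨ b = m) ∧ (d = 0 ∨ d = 1 ∨ d = m) := by
  have key : ∀ a b, WAdj n m a m → WAdj n m b m → WAdj n m a b →
      (a = 0 ∧ b = 1) ∨ (a = 1 ∧ b = 0) := by
    intro a b ha hb hab
    have h1 := wAdj_hub.mp (wAdj_symm ha)
    have h2 := wAdj_hub.mp (wAdj_symm hb)
    rw [wAdj_rim h1.1] at hab
    unfold Rim Spoke at *
    omega
  by_cases ha : a = m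
  · subst ha
    have := key _ _ (wAdj_symm hab) (wAdj_symm had) hbd
    omega
  by_cases hb : b = m
  · subst hb
    have := key _ _ hab (wAdj_symm hbd) had
    omega
  by_cases hd : d = m
  · subst hd
    have := key _ _ had hbd hab
    omega
  unfold WAdj Rim at *
  omega

lemma rigid (hm : 12 * (n + 1) ≤ m) (hn : 1 ≤ n) {f : ℕ → ℕ} (hle : ∀ x ≤ m, f x ≤ m)
    (hinj : ∀ x ≤ m, ∀ y ≤ m, f x = f y → x = y)
    (hf : ∀ x ≤ m, ∀ y ≤ m, WAdj n m x y → WAdj n m (f x) (f y)) : ∀ x ≤ m, f x = x := by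
  have adj_succ : ∀ x, x + 1 < m → WAdj n m (f x) (f (x + 1)) := fun x hx =>
    hf _ (by omega) _ (by omega) (by unfold WAdj Rim; omega)
  have hne : ∀ x y, x ≤ m → y ≤ m → x ≠ y → f x ≠ f y := fun x y hx hy hxy h =>
    hxy (hinj x hx y hy h)
  have h0m : WAdj n m (f 0) (f m) := hf _ (by omega) _ le_rfl (by unfold WAdj Rim Spoke; omega)
  have h1m : WAdj n m (f 1) (f m) := hf _ (by omega) _ le_rfl (by unfold WAdj Rim Spoke; omega)
  have h12m : WAdj n m (f 12) (f m) := hf _ (by omega) _ le_rfl (by unfold WAdj Rim Spoke; omega)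
  have ht := triangle hm hn (adj_succ 0 (by omega)) h1m h0m
  have h11 := wAdj_symm (adj_succ 11 (by omega))
  have h13 := adj_succ 12 (by omega)
  norm_num at h11 h13 ht
  have d01 := hne 0 1 (by omega) (by omega) (by omega)
  have d0m := hne 0 m (by omega) (by omega) (by omega)
  have d1m := hne 1 m (by omega) (by omega) (by omega)
  have hfm : f m = m := by
    have e1 := hne 12 0 (by omega) (by omega) (by omega)
    have e2 := hne 12 1 (by omega) (by omega) (by omega)
    have e3 := hne 12 m (by omega) (by omega) (by omega)
    have e4 := hne 11 13 (by omega) (by omega) (by omega)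
    have e5 := hne 11 m (by omega) (by omega) (by omega)
    have e6 := hne 13 m (by omega) (by omega) (by omega)
    have e7 := hle 12 (by omega)
    have h12 : f 12 < m := by omega
    rw [wAdj_rim h12] at h12m h11 h13
    unfold Rim Spoke at h12m h11 h13
    omega
  have hlt : ∀ x < m, f x < m := fun x hx => by
    have := hne x m hx.le le_rfl hx.ne
    have := hle x hx.le
    omega
  have rim_succ : ∀ x, x + 1 < m → Rim m (f x) (f (x + 1)) := fun x hx => by
    have h1 := hlt (x + 1) hx
    refine ((wAdj_rim (hlt x (by omega))).mp (adj_succ x hx)).resolve_right ?_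
    omega
  have hcases : (f 0 = 0 ∧ f 1 = 1) ∨ (f 0 = 1 ∧ f 1 = 0) := by omega
  rcases hcases with ⟨f0, f1⟩ | ⟨f0, f1⟩
  · have key : ∀ x, x + 1 < m → f x = x ∧ f (x + 1) = x + 1 := by
      intro x
      induction x with
      | zero => exact fun _ => ⟨f0, f1⟩
      | succ x ih =>
        intro hx
        obtain ⟨h1, h2⟩ := ih (by omega)
        have h3 := rim_succ (x + 1) hx
        have h4 := hne x (x + 1 + 1) (by omega) (by omega) (by omega)
        refine ⟨h2, ?_⟩
        unfold Rim at h3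
        omega
    intro x hx
    rcases hx.lt_or_eq with hx | rfl
    · rcases x with - | x
      · exact f0
      · exact (key x hx).2
    · exact hfm
  · exfalso
    have h2 := rim_succ 1 (by omega)
    have h2' := hne 2 0 (by omega) (by omega) (by omega)
    norm_num at h2
    have f2 : f 2 = m - 1 := by
      unfold Rim at h2
      omega
    have key : ∀ x, x + 2 < m → f (x + 1) = (if x = 0 then 0 else m - x) ∧
        f (x + 2) = m - 1 - x := by
      intro x
      induction x with
      | zero => exact fun _ => ⟨f1, f2⟩
      | succ x ih =>
        intro hx
        obtain ⟨h1, h2⟩ := ih (by omega)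
        have h3 : Rim m (f (x + 2)) (f (x + 3)) := rim_succ (x + 2) hx
        have h4 : f (x + 1) ≠ f (x + 3) := hne _ _ (by omega) (by omega) (by omega)
        unfold Rim at h3
        change f (x + 2) = _ ∧ f (x + 3) = _
        rw [if_neg (Nat.succ_ne_zero x)]
        split_ifs at h1 <;> omega
    have h12 := (key 10 (by omega)).2
    rw [hfm] at h12m
    have h3 := (wAdj_hub.mp (wAdj_symm h12m)).2
    norm_num at h12
    unfold Spoke at h3
    omega

lemma trivialAut (hm : 12 * (n + 1) ≤ m) (hn : 1 ≤ n) : TrivialAut (graph n m (by omega)) := by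
  intro e v
  let f : ℕ → ℕ := fun x => if h : x < m + 1 then (e ⟨x, h⟩).val else x
  have hf : ∀ x (h : x ≤ m), f x = (e ⟨x, Nat.lt_succ_of_le h⟩).val := fun x h =>
    dif_pos (Nat.lt_succ_of_le h)
  have := rigid (f := f) hm hn (fun x hx => by rw [hf x hx]; omega)
    (fun x hx y hy h => by
      rw [hf x hx, hf y hy] at h
      have h1 := e.injective (Fin.ext h)
      exact congrArg Fin.val h1)
    (fun x hx y hy h => by
      rw [hf x hx, hf y hy]
      exact e.map_adj_iff.mpr (show (graph n m (by omega)).Adj ⟨x, _⟩ ⟨y, _⟩ from h))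
    v (Nat.le_of_lt_succ v.2)
  rw [hf _ (Nat.le_of_lt_succ v.2)] at this
  exact Fin.ext this

lemma reachable_of_path {W : Type} {H : SimpleGraph W} {S : Set W} (p : ℕ → W) {a b : ℕ}
    (hab : a ≤ b) (hS : ∀ i, a ≤ i → i ≤ b → p i ∈ S)
    (hadj : ∀ i, a ≤ i → i < b → H.Adj (p i) (p (i + 1))) :
    (H.induce S).Reachable ⟨p a, hS a le_rfl hab⟩ ⟨p b, hS b hab le_rfl⟩ := by
  induction b, hab using Nat.le_induction with
  | base => rfl
  | succ b hab ih =>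
    refine (ih (fun i h1 h2 => hS i h1 (by omega)) fun i h1 h2 => hadj i h1 (by omega)).trans ?_
    exact SimpleGraph.Adj.reachable (hadj b hab (by omega) :)

lemma notMem_star {hm : 2 ≤ m} {u v : Fin (m + 1)} :
    v ∉ star (graph n m hm) u ↔ v.val ≠ u.val ∧ ¬WAdj n m u v := by
  change ¬(v = u ∨ WAdj n m u v) ↔ _
  rw [not_or, Fin.ext_iff]

lemma connected (hm : 12 * (n + 1) ≤ m) (hn : 1 ≤ n) {u : Fin (m + 1)} (hu : u.val < m) :
    ((graph n m (by omega)).induce (star (graph n m (by omega)) u)ᶜ).Connected := by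
  let p : ℕ → Fin (m + 1) := fun i =>
    Fin.ofNat (m + 1) (if u + 2 + i < m then u + 2 + i else u + 2 + i - m)
  have hp : ∀ i ≤ m - 4, (p i).val = if u + 2 + i < m then u + 2 + i else u + 2 + i - m :=
    fun i hi => by
      refine Nat.mod_eq_of_lt ?_
      split_ifs <;> omega
  have hS : ∀ i ≤ m - 4, p i ∈ (star (graph n m (by omega)) u)ᶜ := fun i hi => by
    rw [Set.mem_compl_iff, notMem_star, wAdj_rim hu, hp i hi]
    unfold Rim
    split_ifs <;> omega
  have hadj : ∀ i < m - 4, (graph n m (by omega)).Adj (p i) (p (i + 1)) := fun i hi => by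
    change WAdj n m _ _
    rw [hp i (by omega), hp (i + 1) (by omega)]
    unfold WAdj Rim
    split_ifs <;> omega
  have hreach : ∀ v : ((star (graph n m (by omega)) u)ᶜ : Set (Fin (m + 1))), v.1.val < m →
      ((graph n m (by omega)).induce (star (graph n m (by omega)) u)ᶜ).Reachable
        ⟨p 0, hS 0 (by omega)⟩ v := by
    rintro ⟨v, hv⟩ hvm
    have hv' := hv
    rw [Set.mem_compl_iff, notMem_star, wAdj_rim hu] at hv'
    unfold Rim at hv'
    dsimp only at hvm
    obtain ⟨i, hi, rfl⟩ : ∃ i ≤ m - 4, v = p i := by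
      refine ⟨if u.val + 2 ≤ v.val then v - u - 2 else v + m - u - 2, by split_ifs <;> omega,
        Fin.ext ?_⟩
      rw [hp _ (by split_ifs <;> omega)]
      split_ifs <;> omega
    exact reachable_of_path p (Nat.zero_le i) (fun j _ hj => hS j (by omega))
      fun j _ hj => hadj j (by omega)
  rw [SimpleGraph.connected_iff_exists_forall_reachable]
  refine ⟨⟨p 0, hS 0 (by omega)⟩, fun v => ?_⟩
  by_cases hv : v.1.val < m
  · exact hreach v hv
  obtain ⟨v, hvS⟩ := v
  dsimp only at hv
  rw [Set.mem_compl_iff, notMem_star, wAdj_rim hu] at hvS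
  obtain ⟨s, hs, hs'⟩ : ∃ s : ℕ, (s = 0 ∨ s = 12) ∧ s ≠ u ∧ ¬Rim m u s := by
    by_contra! h
    have h1 := h 0 (by omega)
    have h2 := h 12 (by omega)
    unfold Rim Spoke at *
    omega
  have hsS : (⟨s, by omega⟩ : Fin (m + 1)) ∈ (star (graph n m (by omega)) u)ᶜ := by
    rw [Set.mem_compl_iff, notMem_star, wAdj_rim hu]
    refine ⟨hs'.1, ?_⟩
    rintro (h | h)
    · exact hs'.2 h
    · have := h.1
      dsimp only at this
      omega
  refine (hreach ⟨_, hsS⟩ (by dsimp only; omega)).trans ?_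
  refine SimpleGraph.Adj.reachable (?_ : WAdj n m s v)
  rw [wAdj_rim (by omega)]
  refine .inr ⟨by omega, ?_⟩
  unfold Spoke
  omega

open scoped Classical in
/-- The labels of the components of the complement of the star of the hub. -/
def label (n m : ℕ) (v : Fin (m + 1)) : Option (Fin n) :=
  if h : v.val / 12 < n ∧ v.val < m ∧ ¬Spoke n v then some ⟨v.val / 12, h.1⟩ else none

lemma label_eq_some {v : Fin (m + 1)} {i : Fin n} :
    label n m v = some i ↔ v.val / 12 = i ∧ v.val < m ∧ ¬Spoke n v := by
  unfold label
  split_ifs with h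
  · rw [Option.some_inj, Fin.ext_iff]
    exact ⟨fun h' => ⟨h', h.2⟩, fun h' => h'.1⟩
  · simp only [false_iff]
    exact fun h' => h ⟨h'.1 ▸ i.2, h'.2⟩

lemma label_eq_none {v : Fin (m + 1)} :
    label n m v = none ↔ ¬(v.val / 12 < n ∧ v.val < m ∧ ¬Spoke n v) := by
  unfold label
  split_ifs with h <;> simp [h]

lemma label_eq_iff {v w : Fin (m + 1)} (hv : v.val < m ∧ ¬Spoke n v) (hw : w.val < m ∧ ¬Spoke n w) :
    label n m v = label n m w ↔
      v.val / 12 = w.val / 12 ∨ (n ≤ v.val / 12 ∧ n ≤ w.val / 12) := by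
  by_cases h : v.val / 12 < n
  · have h1 : label n m v = some ⟨_, h⟩ := label_eq_some.mpr ⟨rfl, hv⟩
    rw [h1, eq_comm, label_eq_some]
    constructor
    · exact fun h => .inl h.1.symm
    · exact fun h' => ⟨by dsimp only; omega, hw⟩
  · have h1 : label n m v = none := label_eq_none.mpr fun h' => h h'.1
    rw [h1, eq_comm, label_eq_none]
    have := hw.2
    have := hw.1
    constructor
    · intro h'
      by_contra
      exact h' ⟨by omega, hw⟩
    · intro h' h''
      omega

lemma notMem_star_hub {hm : 2 ≤ m} {v : Fin (m + 1)} :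
    v ∉ star (graph n m hm) (Fin.last m) ↔ v.val < m ∧ ¬Spoke n v := by
  rw [notMem_star, Fin.val_last, wAdj_hub]
  have := v.2
  constructor
  · rintro ⟨h1, h2⟩
    exact ⟨by omega, fun h => h2 ⟨by omega, h⟩⟩
  · rintro ⟨h1, h2⟩
    exact ⟨by omega, fun h => h2 h.2⟩

lemma reachable_of_label_eq (hm : 2 ≤ m) (hn : 1 ≤ n)
    {v w : ((star (graph n m hm) (Fin.last m))ᶜ : Set (Fin (m + 1)))} (hvw : v.1.val ≤ w.1.val)
    (h : label n m v = label n m w) :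
    ((graph n m hm).induce (star (graph n m hm) (Fin.last m))ᶜ).Reachable v w := by
  obtain ⟨v, hv⟩ := v
  obtain ⟨w, hw⟩ := w
  have hv' := notMem_star_hub.mp hv
  have hw' := notMem_star_hub.mp hw
  rw [label_eq_iff hv' hw'] at h
  dsimp only at hvw h
  have hval : ∀ i ≤ m, (Fin.ofNat (m + 1) i).val = i := fun i hi =>
    Nat.mod_eq_of_lt (by omega)
  have := reachable_of_path (H := graph n m hm) (S := (star (graph n m hm) (Fin.last m))ᶜ)
    (Fin.ofNat (m + 1)) hvw (fun i h1 h2 => by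
      rw [Set.mem_compl_iff, notMem_star_hub, hval i (by omega)]
      unfold Spoke at *
      omega) (fun i h1 h2 => by
      change WAdj n m _ _
      rw [hval i (by omega), hval (i + 1) (by omega)]
      unfold WAdj Rim
      omega)
  simpa using this

theorem isHub (hm : 12 * (n + 1) ≤ m) (hn : 1 ≤ n) :
    RAAG.IsHub (graph n m (by omega)) (Fin.last m) (label n m) where
  not_dominates u v huv h := by
    obtain ⟨w, hw, hvw, hwu, huw⟩ := exists_wAdj_not (u := u) (v := v) hm hn
      (by omega) (by omega) fun h => huv (Fin.ext h)
    exact notMem_star.mpr ⟨hwu, huw⟩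
      (h (show (⟨w, by omega⟩ : Fin (m + 1)) ∈ (graph n m (by omega)).neighborSet v from hvw))
  trivialAut := trivialAut hm hn
  connected u hu := connected hm hn (by
    have h : ¬u.val = m := fun h => hu (Fin.ext h)
    omega)
  lab_eq_none v hv := label_eq_none.mpr fun h => notMem_star_hub.mpr h.2 hv
  lab_eq_of_adj v w hv hw h := by
    rw [notMem_star_hub] at hv hw
    rw [label_eq_iff hv hw]
    replace h : WAdj n m v w := h
    rw [wAdj_rim hv.1] at h
    unfold Rim Spoke at *
    omega
  reachable v w h := by
    rcases le_total v.1.val w.1.val with hvw | hvw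
    · exact reachable_of_label_eq (by omega) hn hvw h
    · exact (reachable_of_label_eq (by omega) hn hvw h.symm).symm
  exists_notMem i u u' := by
    obtain ⟨b, hb, hlab⟩ : ∃ b ≤ n, ∀ v : Fin (m + 1), v.val / 12 = b → v.val < m ∧ ¬Spoke n v →
        label n m v = i := by
      cases i with
      | none => exact ⟨n, le_rfl, fun v hv _ => label_eq_none.mpr (by omega)⟩
      | some i => exact ⟨i, i.2.le, fun v hv hv' => label_eq_some.mpr ⟨hv, hv'⟩⟩
    obtain ⟨k, hk, hku, hku'⟩ : ∃ k : ℕ, (k = 3 ∨ k = 6 ∨ k = 9) ∧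
        (u.val = m ∨ u.val + 1 < 12 * b + k ∨ 12 * b + k + 1 < u) ∧
        (u'.val = m ∨ u'.val + 1 < 12 * b + k ∨ 12 * b + k + 1 < u') := by
      by_contra! h
      have h1 := h 3
      have h2 := h 6
      have h3 := h 9
      omega
    have hv : 12 * b + k < m ∧ ¬Spoke n (12 * b + k) := by
      unfold Spoke
      omega
    have hstar : ∀ u : Fin (m + 1),
        (u.val = m ∨ u.val + 1 < 12 * b + k ∨ 12 * b + k + 1 < u) →
        (⟨12 * b + k, by omega⟩ : Fin (m + 1)) ∉ star (graph n m (by omega)) u := fun u hu => by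
      rw [notMem_star]
      unfold WAdj Rim Spoke at *
      dsimp only
      omega
    exact ⟨⟨12 * b + k, by omega⟩, hlab _ (by dsimp only; omega) hv, notMem_star_hub.mpr hv,
      hstar u hku, hstar u' hku'⟩

end Wheel

/-- For each `n ≥ 1` there are focused graphs with arbitrarily many vertices such that
`GL_n(ℤ)` embeds in `Aut(Out(A_Γ))` and `PGL_n(ℤ)` embeds in `Out(Out(A_Γ))`. -/
theorem stmt11 (n : ℕ) (hn : 1 ≤ n) (N : ℕ) :
    ∃ (V : Type) (_ : Fintype V) (G : SimpleGraph V) (c : V),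
      Focused G c ∧ TrivialAut G ∧ N < Nat.card V ∧
      (∃ f : GLZ n →* MulAut (Out (RAAG G)), Function.Injective f) ∧
      (∃ f : PGLZ n →* Out (Out (RAAG G)), Function.Injective f) := by
  have hub := Wheel.isHub (m := 12 * (n + 1) + N) (by omega) hn
  exact ⟨_, inferInstance, _, _,
    ⟨fun u v huv h => absurd h (hub.not_dominates u v huv), hub.connected⟩, hub.trivialAut,
    by rw [Nat.card_eq_fintype_card, Fintype.card_fin]; omega, hub.exists_embeddings hn⟩
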